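/- arXiv:2511.03814 — 4 statements merged into one kernel-verified Lean document; each statement's English description precedes it below -/
import Mathlib

section
/- Let N be a nondeterministic finite automaton over an alphabet Σ with finite state set Q and accepting set F. Let S, T ⊆ Q and let q ∈ S \ T. If the singleton {q} is co-reachable in N (i.e. there is a word u such that {p ∈ Q : N.evalFrom {p} u meets F} = {q}), then S and T are distinguishable in the subset automaton: there exists a word v such that N.evalFrom S v meets F while N.evalFrom T v does not meet F. -/
/-- A word is accepted from `S` if and only if it is accepted from some element of `S`. -/
theorem NFA.evalFrom_inter_accept_nonempty_iff {α σ : Type*} (M : NFA α σ) (S : Set σ)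
    (x : List α) :
    (M.evalFrom S x ∩ M.accept).Nonempty ↔
      ∃ p ∈ S, (M.evalFrom {p} x ∩ M.accept).Nonempty := by
  rw [NFA.evalFrom_eq_biUnion_singleton, Set.iUnion₂_inter]
  simp only [Set.nonempty_iUnion, exists_prop]

/-- If the singleton `{q}` is co-reachable in the NFA `N` and `q ∈ S \ T`, then the subset-automaton
states `S` and `T` are distinguishable: some word is accepted from `S` but not from `T`. -/
theorem stmt0 {σ Q : Type} [Fintype Q] (N : NFA σ Q) (S T : Set Q) (q : Q)
    (hq : q ∈ S \ T)
    (hco : ∃ u : List σ, {p : Q | (N.evalFrom {p} u ∩ N.accept).Nonempty} = {q}) :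
    ∃ v : List σ,
      (N.evalFrom S v ∩ N.accept).Nonempty ∧ ¬ (N.evalFrom T v ∩ N.accept).Nonempty := by
  obtain ⟨u, hu⟩ := hco
  have accepted_iff (p : Q) : (N.evalFrom {p} u ∩ N.accept).Nonempty ↔ p = q :=
    Set.ext_iff.mp hu p
  refine ⟨u, ?_, ?_⟩ <;>
    rw [N.evalFrom_inter_accept_nonempty_iff] <;>
    simp only [accepted_iff, exists_eq_right]
  exacts [hq.1, hq.2]
end

section
/- Let k ≥ 2, let j ∈ {1,…,k}, let n_j = 1 and n_i ≥ 2 for all i ≠ j. Let A₁,…,A_k be DFAs with n_i states over a common alphabet Σ such that A_j has a single state which is both initial and accepting (so L(A_j) = Σ*), and such that every A_i with i ≤ k−1 and i ≠ j has exactly one accepting state, distinct from its start state. Let L = L(A₁)L(A₂)⋯L(A_k), and consider the downward recursion U_i = 1+(2^{n_i−1}−1)·U_{i+1}+2^{n_i−1}·V_{i+1}, V_i = 2^{n_i−2}·(U_{i+1}+V_{i+1}), with base cases as indicated. Then: (1) if j = 1, L is accepted by a DFA with at most V₂ states, the recursion running over indices 2,…,k with base U_k = 2^{n_k}, V_k =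 2^{n_k−1}; (2) if j = k = 2, L is accepted by a DFA with at most n₁ states; (3) if j = k ≥ 3, L is accepted by a DFA with at most (n₁−1)·U₂+V₂+1 states, the recursion running over indices 2,…,k−1 with base U_{k−1} = 2^{n_{k−1}−1}, V_{k−1} = 2^{n_{k−1}−2}; (4) if 2 ≤ j ≤ k−1, L is accepted by a DFA with at most C + V_{j+1} states, where V_{j+1} is computed by the recursion over indices j+1,…,k with base U_k = 2^{n_k}, V_k = 2^{n_k−1}, and where C = n₁−1 if j = 2, and C = (n₁−1)·U₂+V₂ computed by the recursion over indices 2,…,j−1 with base U_{j−1} = 2^{n_{j−1}−1}, V_{j−1} = 2^{n_{j−1}−2} if j ≥ 3. -/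
/-- Downward recursion with base `U = 2^{n_k}`, `V = 2^{n_k−1}` at the last index. -/
def UV : List ℕ → ℕ × ℕ
  | [] => (1, 1)
  | [m] => (2 ^ m, 2 ^ (m - 1))
  | m :: rest =>
      (1 + (2 ^ (m - 1) - 1) * (UV rest).1 + 2 ^ (m - 1) * (UV rest).2,
       2 ^ (m - 2) * ((UV rest).1 + (UV rest).2))

/-- Downward recursion with base `U = 2^{n−1}`, `V = 2^{n−2}` at the last index. -/
def UV' : List ℕ → ℕ × ℕ
  | [] => (1, 1)
  | [m] => (2 ^ (m - 1), 2 ^ (m - 2))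
  | m :: rest =>
      (1 + (2 ^ (m - 1) - 1) * (UV' rest).1 + 2 ^ (m - 1) * (UV' rest).2,
       2 ^ (m - 2) * ((UV' rest).1 + (UV' rest).2))

/-- `L` is accepted by some (complete, finite) DFA with at most `m` states. -/
def AcceptedByAtMost (σ : Type) (L : Language σ) (m : ℕ) : Prop :=
  ∃ (Q : Type) (_ : Fintype Q) (D : DFA σ Q), D.accepts = L ∧ Fintype.card Q ≤ m

section

open Finset

namespace Language

variable {σ : Type}

theorem leftQuotient_zero (x : List σ) : (0 : Language σ).leftQuotient x = 0 := rfl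

theorem leftQuotient_mul_add {X N Y : Language σ} (h : [] ∈ X → N ≤ Y) (a : σ) :
    (X * N + Y).leftQuotient [a] = X.leftQuotient [a] * N + Y.leftQuotient [a] := by
  ext w
  simp only [mem_leftQuotient, mem_add, mem_mul, List.cons_append, List.nil_append]
  constructor
  · rintro (⟨x, hx, y, hy, hxy⟩ | hw)
    · cases x with
      | nil =>
        rw [List.nil_append] at hxy
        exact Or.inr (h hx (hxy ▸ hy))
      | cons b x =>
        rw [List.cons_append, List.cons.injEq] at hxy
        obtain ⟨rfl, hxy⟩ := hxy
        exact Or.inl ⟨x, hx, y, hy, hxy⟩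
    · exact Or.inr hw
  · rintro (⟨x, hx, y, hy, rfl⟩ | hw)
    · exact Or.inl ⟨a :: x, hx, y, hy, rfl⟩
    · exact Or.inr hw

theorem le_mul_of_nil_mem {X N : Language σ} (h : [] ∈ X) : N ≤ X * N :=
  fun w hw => mem_mul.2 ⟨[], h, w, hw, rfl⟩

theorem mul_top_mul_le (Z N : Language σ) : Z * (⊤ * N) ≤ ⊤ * N := by
  rw [← mul_assoc]
  exact mul_le_mul_left le_top N

end Language

namespace DFA

variable {σ Q : Type} (M : DFA σ Q)

/-- The words sent from some state of `S` to an accepting state. -/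
def acceptsFromFinset (S : Finset Q) : Language σ :=
  {w | ∃ q ∈ S, M.evalFrom q w ∈ M.accept}

theorem mem_acceptsFromFinset {S : Finset Q} {w : List σ} :
    w ∈ M.acceptsFromFinset S ↔ ∃ q ∈ S, M.evalFrom q w ∈ M.accept := Iff.rfl

theorem acceptsFromFinset_start : M.acceptsFromFinset {M.start} = M.accepts := by
  ext w
  simp [mem_acceptsFromFinset, mem_accepts, eval]

theorem acceptsFromFinset_insert_start [DecidableEq Q] (S : Finset Q) :
    M.acceptsFromFinset (insert M.start S) = M.acceptsFromFinset S + M.accepts := by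
  ext w
  simp [mem_acceptsFromFinset, mem_accepts, eval, Language.mem_add, or_comm]

theorem acceptsFromFinset_empty : M.acceptsFromFinset ∅ = 0 := by
  ext w
  simp [mem_acceptsFromFinset]

theorem leftQuotient_acceptsFromFinset [DecidableEq Q] (S : Finset Q) (a : σ) :
    (M.acceptsFromFinset S).leftQuotient [a] = M.acceptsFromFinset (S.image (M.step · a)) := by
  ext w
  simp [mem_acceptsFromFinset]

theorem nil_mem_acceptsFromFinset {f : Q} (hf : M.accept = {f}) (S : Finset Q) :
    [] ∈ M.acceptsFromFinset S ↔ f ∈ S := by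
  simp [mem_acceptsFromFinset, hf]

end DFA

namespace Finset

variable {Q : Type} [Fintype Q] [DecidableEq Q]

theorem card_filter_mem_le (s : Q) :
    #{S : Finset Q | s ∈ S} ≤ 2 ^ (Fintype.card Q - 1) := by
  have h : ({S : Finset Q | s ∈ S} : Finset _) ⊆ (univ.erase s).powerset.image (insert s) := by
    intro S hS
    simp only [mem_filter_univ] at hS
    exact mem_image.2 ⟨S.erase s, mem_powerset.2 (erase_subset_erase s (subset_univ S)),
      insert_erase hS⟩
  refine (card_le_card h).trans (card_image_le.trans ?_)
  rw [card_powerset, card_erase_of_mem (mem_univ s), card_univ]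

theorem card_filter_notMem_le (f : Q) :
    #{S : Finset Q | f ∉ S} ≤ 2 ^ (Fintype.card Q - 1) := by
  have h : ({S : Finset Q | f ∉ S} : Finset _) ⊆ (univ.erase f).powerset := by
    intro S hS
    simp only [mem_filter_univ] at hS
    simp [subset_erase, hS]
  refine (card_le_card h).trans ?_
  rw [card_powerset, card_erase_of_mem (mem_univ f), card_univ]

theorem card_filter_nonempty_notMem_le (f : Q) :
    #{S : Finset Q | S.Nonempty ∧ f ∉ S} ≤ 2 ^ (Fintype.card Q - 1) - 1 := by
  have h : ({S : Finset Q | S.Nonempty ∧ f ∉ S} : Finset _) =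
      ({S : Finset Q | f ∉ S} : Finset _).erase ∅ := by
    ext S
    simp [nonempty_iff_ne_empty]
  rw [h, card_erase_of_mem (by simp)]
  exact Nat.sub_le_sub_right (card_filter_notMem_le f) 1

theorem card_filter_mem_notMem_le {s f : Q} (hfs : f ≠ s) :
    #{S : Finset Q | s ∈ S ∧ f ∉ S} ≤ 2 ^ (Fintype.card Q - 2) := by
  have h : ({S : Finset Q | s ∈ S ∧ f ∉ S} : Finset _) ⊆
      ((univ.erase f).erase s).powerset.image (insert s) := by
    intro S hS
    simp only [mem_filter_univ] at hS
    refine mem_image.2 ⟨S.erase s, mem_powerset.2 (erase_subset_erase s ?_), insert_erase hS.1⟩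
    simp [subset_erase, hS.2]
  refine (card_le_card h).trans (card_image_le.trans ?_)
  rw [card_powerset, card_erase_of_mem (by simp [hfs.symm]), card_erase_of_mem (mem_univ f),
    card_univ, Nat.sub_sub]

theorem card_filter_mem_mem_le {s f : Q} (hfs : f ≠ s) :
    #{S : Finset Q | s ∈ S ∧ f ∈ S} ≤ 2 ^ (Fintype.card Q - 2) := by
  have h : ({S : Finset Q | s ∈ S ∧ f ∈ S} : Finset _) ⊆
      ({S : Finset Q | s ∈ S ∧ f ∉ S} : Finset _).image (insert f) := by
    intro S hS
    simp only [mem_filter_univ] at hS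
    refine mem_image.2 ⟨S.erase f, ?_, insert_erase hS.2⟩
    simp [hS.1, hfs.symm]
  exact (card_le_card h).trans (card_image_le.trans (card_filter_mem_notMem_le hfs))

end Finset

open Language

variable {σ : Type}

/-- A finite family of languages closed under left quotients by letters yields a DFA for each of
its members. -/
theorem acceptedByAtMost_of_leftQuotient_mem {L : Language σ} {𝒟 : Finset (Language σ)} {m : ℕ}
    (hL : L ∈ 𝒟) (h𝒟 : ∀ X ∈ 𝒟, ∀ a, X.leftQuotient [a] ∈ 𝒟) (hm : #𝒟 ≤ m) :
    AcceptedByAtMost σ L m := by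
  let D : DFA σ 𝒟 :=
    { step := fun X a => ⟨X.1.leftQuotient [a], h𝒟 X.1 X.2 a⟩
      start := ⟨L, hL⟩
      accept := {X | [] ∈ X.1} }
  have key : ∀ (w : List σ) (X : 𝒟), w ∈ D.acceptsFrom X ↔ w ∈ X.1 := by
    intro w
    induction w with
    | nil => exact fun X => Iff.rfl
    | cons a w ih => exact fun X => ih (D.step X a)
  refine ⟨𝒟, inferInstance, D, ?_, by simpa using hm⟩
  ext w
  exact key w D.start

/-- `𝒰` is a family of languages closed, up to `E`, under left quotients by letters and under
adding `N`; the members of `𝒱` are those known to contain `N`. -/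
structure RestartFamily (E : Set (Language σ)) (N : Language σ)
    (𝒰 𝒱 : Finset (Language σ)) : Prop where
  zero_mem : 0 ∈ 𝒰
  leftQuotient_mem : ∀ X ∈ 𝒰, ∀ a, X.leftQuotient [a] ∈ 𝒰 ∨ X.leftQuotient [a] ∈ E
  add_mem : ∀ X ∈ 𝒰, X + N ∈ 𝒱
  le_of_mem : ∀ X ∈ 𝒱, N ≤ X
  subset : 𝒱 ⊆ 𝒰

/-- Existence of a restart family with cardinality bounds `b = (u, v)`. -/
def HasRestartFamily (E : Set (Language σ)) (N : Language σ) (b : ℕ × ℕ) : Prop :=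
  ∃ 𝒰 𝒱, RestartFamily E N 𝒰 𝒱 ∧ #𝒰 ≤ b.1 ∧ #𝒱 ≤ b.2

/-- `L` is accepted by an `m`-state DFA with one accepting state, which is not the start state. -/
def OneFinal (m : ℕ) (L : Language σ) : Prop :=
  ∃ (Q : Type) (_ : Fintype Q) (D : DFA σ Q) (f : Q),
    Fintype.card Q = m ∧ D.accept = {f} ∧ f ≠ D.start ∧ D.accepts = L

/-- Adding a language of the form `Z * N` to a member of `E` gives a member of `E`. -/
def AbsorbsMul (E : Set (Language σ)) (N : Language σ) : Prop :=
  ∀ Z, ∀ Y ∈ E, Z * N + Y ∈ E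

theorem AbsorbsMul.mul {E : Set (Language σ)} {N : Language σ} (h : AbsorbsMul E N)
    (L : Language σ) :
    AbsorbsMul E (L * N) := by
  intro Z Y hY
  rw [← mul_assoc]
  exact h _ Y hY

theorem absorbsMul_singleton {R : Language σ} (hR : ∀ Z, Z * R ≤ R) : AbsorbsMul {R} R := by
  rintro Z Y rfl
  exact add_eq_right_iff_le.2 (hR Z)

theorem RestartFamily.leftQuotient_mul_add {E : Set (Language σ)}
    {N : Language σ} {𝒰 𝒱 : Finset (Language σ)} (h : RestartFamily E N 𝒰 𝒱) (hE : AbsorbsMul E N)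
    {Q : Type} [DecidableEq Q] {M : DFA σ Q} {f : Q} (hf : M.accept = {f}) (S : Finset Q)
    {Y : Language σ} (hY : Y ∈ 𝒰) (hSY : f ∈ S → Y ∈ 𝒱) (a : σ) :
    (∃ Y' ∈ 𝒰, (f ∈ S.image (M.step · a) → Y' ∈ 𝒱) ∧
      (M.acceptsFromFinset S * N + Y).leftQuotient [a] =
        M.acceptsFromFinset (S.image (M.step · a)) * N + Y') ∨
      (M.acceptsFromFinset S * N + Y).leftQuotient [a] ∈ E := by
  have hnil : [] ∈ M.acceptsFromFinset S → N ≤ Y := fun hS =>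
    h.le_of_mem Y (hSY ((M.nil_mem_acceptsFromFinset hf S).1 hS))
  rw [Language.leftQuotient_mul_add hnil, M.leftQuotient_acceptsFromFinset]
  rcases h.leftQuotient_mem Y hY a with hYa | hYa
  · left
    by_cases hfS : f ∈ S.image (M.step · a)
    · have hYN := h.add_mem _ hYa
      refine ⟨_, h.subset hYN, fun _ => hYN, ?_⟩
      rw [add_comm _ N, ← add_assoc, add_eq_left_iff_le.2
        (le_mul_of_nil_mem ((M.nil_mem_acceptsFromFinset hf _).2 hfS))]
    · exact ⟨_, hYa, fun hf' => absurd hf' hfS, rfl⟩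
  · exact Or.inr (hE _ _ hYa)

theorem HasRestartFamily.mul {E : Set (Language σ)} {N L : Language σ} {b : ℕ × ℕ} {m : ℕ}
    (h : HasRestartFamily E N b) (hE : AbsorbsMul E N) (hL : OneFinal m L) :
    HasRestartFamily E (L * N)
      (1 + (2 ^ (m - 1) - 1) * b.1 + 2 ^ (m - 1) * b.2, 2 ^ (m - 2) * (b.1 + b.2)) := by
  classical
  obtain ⟨𝒰, 𝒱, h, hu, hv⟩ := h
  obtain ⟨Q, _, M, f, rfl, hf, hfs, rfl⟩ := hL
  let g : Finset Q → Language σ → Language σ := fun S Y => M.acceptsFromFinset S * N + Y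
  have hgU : ∀ X, X ∈ ({0} ∪ image₂ g {S | S.Nonempty ∧ f ∉ S} 𝒰 ∪ image₂ g {S | f ∈ S} 𝒱) ↔
      X = 0 ∨ ∃ S Y, S.Nonempty ∧ Y ∈ 𝒰 ∧ (f ∈ S → Y ∈ 𝒱) ∧ g S Y = X := by
    intro X
    simp only [mem_union, mem_singleton, mem_image₂, mem_filter_univ]
    constructor
    · rintro ((hX | ⟨S, ⟨hS, hfS⟩, Y, hY, rfl⟩) | ⟨S, hfS, Y, hY, rfl⟩)
      · exact Or.inl hX
      · exact Or.inr ⟨S, Y, hS, hY, fun h => absurd h hfS, rfl⟩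
      · exact Or.inr ⟨S, Y, ⟨f, hfS⟩, h.subset hY, fun _ => hY, rfl⟩
    · rintro (hX | ⟨S, Y, hS, hY, hSY, rfl⟩)
      · exact Or.inl (Or.inl hX)
      · by_cases hfS : f ∈ S
        · exact Or.inr ⟨S, hfS, Y, hSY hfS, rfl⟩
        · exact Or.inl (Or.inr ⟨S, ⟨hS, hfS⟩, Y, hY, rfl⟩)
  have hgV : ∀ X, X ∈ (image₂ g {S | M.start ∈ S ∧ f ∉ S} 𝒰 ∪
        image₂ g {S | M.start ∈ S ∧ f ∈ S} 𝒱) ↔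
      ∃ S Y, M.start ∈ S ∧ Y ∈ 𝒰 ∧ (f ∈ S → Y ∈ 𝒱) ∧ g S Y = X := by
    intro X
    simp only [mem_union, mem_image₂, mem_filter_univ]
    constructor
    · rintro (⟨S, ⟨hS, hfS⟩, Y, hY, rfl⟩ | ⟨S, ⟨hS, hfS⟩, Y, hY, rfl⟩)
      · exact ⟨S, Y, hS, hY, fun h => absurd h hfS, rfl⟩
      · exact ⟨S, Y, hS, h.subset hY, fun _ => hY, rfl⟩
    · rintro ⟨S, Y, hS, hY, hSY, rfl⟩
      by_cases hfS : f ∈ S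
      · exact Or.inr ⟨S, ⟨hS, hfS⟩, Y, hSY hfS, rfl⟩
      · exact Or.inl ⟨S, ⟨hS, hfS⟩, Y, hY, rfl⟩
  refine ⟨_, image₂ g {S | M.start ∈ S ∧ f ∉ S} 𝒰 ∪ image₂ g {S | M.start ∈ S ∧ f ∈ S} 𝒱,
    ⟨(hgU 0).2 (Or.inl rfl), ?_, ?_, ?_, ?_⟩, ?_, ?_⟩
  · intro X hX a
    rcases (hgU X).1 hX with rfl | ⟨S, Y, hS, hY, hSY, rfl⟩
    · exact Or.inl hX
    · refine (h.leftQuotient_mul_add hE hf S hY hSY a).imp_left ?_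
      rintro ⟨Y', hY', hSY', heq⟩
      exact (hgU _).2 (Or.inr ⟨_, Y', hS.image _, hY', hSY', heq.symm⟩)
  · intro X hX
    rw [hgV]
    rcases (hgU X).1 hX with rfl | ⟨S, Y, hS, hY, hSY, rfl⟩
    · refine ⟨{M.start}, 0, by simp, h.zero_mem, by simp [hfs], ?_⟩
      simp [g, M.acceptsFromFinset_start]
    · refine ⟨insert M.start S, Y, by simp, hY, by simpa [hfs] using hSY, ?_⟩
      simp only [g, M.acceptsFromFinset_insert_start, add_mul]
      rw [add_right_comm]
  · intro X hX
    obtain ⟨S, Y, hS, hY, hSY, rfl⟩ := (hgV X).1 hX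
    simp only [g]
    rw [← insert_eq_of_mem hS, M.acceptsFromFinset_insert_start, add_mul, add_right_comm]
    exact le_add_self
  · intro X hX
    obtain ⟨S, Y, hS, hY, hSY, rfl⟩ := (hgV X).1 hX
    exact (hgU _).2 (Or.inr ⟨S, Y, ⟨_, hS⟩, hY, hSY, rfl⟩)
  · refine (card_union_le _ _).trans (add_le_add ((card_union_le _ _).trans (add_le_add ?_ ?_)) ?_)
    · simp
    · exact (card_image₂_le _ _ _).trans
        (Nat.mul_le_mul (card_filter_nonempty_notMem_le f) hu)
    · exact (card_image₂_le _ _ _).trans (Nat.mul_le_mul (card_filter_mem_le f) hv)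
  · rw [mul_add]
    refine (card_union_le _ _).trans (add_le_add ?_ ?_)
    · exact (card_image₂_le _ _ _).trans (Nat.mul_le_mul (card_filter_mem_notMem_le hfs) hu)
    · exact (card_image₂_le _ _ _).trans (Nat.mul_le_mul (card_filter_mem_mem_le hfs) hv)

theorem hasRestartFamily_accepts {Q : Type} [Fintype Q] (M : DFA σ Q) :
    HasRestartFamily ∅ M.accepts (2 ^ Fintype.card Q, 2 ^ (Fintype.card Q - 1)) := by
  classical
  refine ⟨univ.image M.acceptsFromFinset,
    ({S : Finset Q | M.start ∈ S} : Finset _).image M.acceptsFromFinset, ⟨?_, ?_, ?_, ?_, ?_⟩,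
    ?_, card_image_le.trans (card_filter_mem_le _)⟩
  · exact mem_image.2 ⟨∅, mem_univ _, M.acceptsFromFinset_empty⟩
  · simp [DFA.leftQuotient_acceptsFromFinset]
  · simp only [forall_mem_image]
    exact fun S _ => mem_image.2 ⟨insert M.start S, by simp, M.acceptsFromFinset_insert_start S⟩
  · simp only [forall_mem_image, mem_filter_univ]
    intro S hS
    rw [← insert_eq_of_mem hS, M.acceptsFromFinset_insert_start]
    exact le_add_self
  · exact image_subset_image (subset_univ _)
  · exact card_image_le.trans (by simp)

theorem leftQuotient_acceptsFromFinset_mul {R : Language σ} (hR : ∀ Z, Z * R ≤ R)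
    {Q : Type} [DecidableEq Q] {M : DFA σ Q} {f : Q} (hf : M.accept = {f}) {S : Finset Q}
    (hS : f ∉ S) (a : σ) :
    (f ∉ S.image (M.step · a) ∧ (M.acceptsFromFinset S * R).leftQuotient [a] =
        M.acceptsFromFinset (S.image (M.step · a)) * R) ∨
      (M.acceptsFromFinset S * R).leftQuotient [a] = R := by
  have hnil : [] ∈ M.acceptsFromFinset S → R ≤ 0 := fun h =>
    absurd ((M.nil_mem_acceptsFromFinset hf S).1 h) hS
  have key : (M.acceptsFromFinset S * R).leftQuotient [a] =
      M.acceptsFromFinset (S.image (M.step · a)) * R := by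
    simpa only [add_zero, leftQuotient_zero, M.leftQuotient_acceptsFromFinset] using
      Language.leftQuotient_mul_add hnil a
  by_cases hfS : f ∈ S.image (M.step · a)
  · right
    rw [key]
    exact le_antisymm (hR _) (le_mul_of_nil_mem ((M.nil_mem_acceptsFromFinset hf _).2 hfS))
  · exact Or.inl ⟨hfS, key⟩

theorem hasRestartFamily_mul {R L : Language σ} (hR : ∀ Z, Z * R ≤ R) {m : ℕ}
    (hL : OneFinal m L) : HasRestartFamily {R} (L * R) (2 ^ (m - 1), 2 ^ (m - 2)) := by
  classical
  obtain ⟨Q, _, M, f, rfl, hf, hfs, rfl⟩ := hL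
  refine ⟨({S : Finset Q | f ∉ S} : Finset _).image (M.acceptsFromFinset · * R),
    ({S : Finset Q | M.start ∈ S ∧ f ∉ S} : Finset _).image (M.acceptsFromFinset · * R),
    ⟨?_, ?_, ?_, ?_, ?_⟩, card_image_le.trans (card_filter_notMem_le _),
    card_image_le.trans (card_filter_mem_notMem_le hfs)⟩
  · exact mem_image.2 ⟨∅, by simp, by simp [M.acceptsFromFinset_empty]⟩
  · simp only [forall_mem_image, mem_filter_univ]
    intro S hS a
    refine (leftQuotient_acceptsFromFinset_mul hR hf hS a).imp_left ?_
    rintro ⟨hfS, heq⟩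
    exact mem_image.2 ⟨_, by simpa using hfS, heq.symm⟩
  · simp only [forall_mem_image, mem_filter_univ]
    intro S hS
    refine mem_image.2 ⟨insert M.start S, by simp [hfs, hS], ?_⟩
    rw [M.acceptsFromFinset_insert_start, add_mul]
  · simp only [forall_mem_image, mem_filter_univ]
    rintro S ⟨hS, -⟩
    rw [← insert_eq_of_mem hS, M.acceptsFromFinset_insert_start, add_mul]
    exact le_add_self
  · exact image_subset_image fun S hS => by
      simp only [mem_filter_univ] at hS ⊢
      exact hS.2

theorem HasRestartFamily.exists_mul {E : Set (Language σ)} {N L : Language σ} {b : ℕ × ℕ} {m : ℕ}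
    (h : HasRestartFamily E N b) (hE : AbsorbsMul E N) (hL : OneFinal m L) :
    ∃ 𝒞 : Finset (Language σ), L * N ∈ 𝒞 ∧ #𝒞 ≤ (m - 1) * b.1 + b.2 ∧
      ∀ X ∈ 𝒞, ∀ a, X.leftQuotient [a] ∈ 𝒞 ∨ X.leftQuotient [a] ∈ E := by
  classical
  obtain ⟨𝒰, 𝒱, h, hu, hv⟩ := h
  obtain ⟨Q, _, M, f, rfl, hf, hfs, rfl⟩ := hL
  let g : Q → Language σ → Language σ := fun q Y => M.acceptsFromFinset {q} * N + Y
  have hg : ∀ X, X ∈ (image₂ g (univ.erase f) 𝒰 ∪ image₂ g {f} 𝒱) ↔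
      ∃ q Y, Y ∈ 𝒰 ∧ (f = q → Y ∈ 𝒱) ∧ g q Y = X := by
    intro X
    simp only [mem_union, mem_image₂, mem_erase, mem_univ, and_true, mem_singleton]
    constructor
    · rintro (⟨q, hq, Y, hY, rfl⟩ | ⟨q, rfl, Y, hY, rfl⟩)
      · exact ⟨q, Y, hY, fun h => absurd h.symm hq, rfl⟩
      · exact ⟨_, Y, h.subset hY, fun _ => hY, rfl⟩
    · rintro ⟨q, Y, hY, hqY, rfl⟩
      by_cases hq : f = q
      · exact Or.inr ⟨q, hq.symm, Y, hqY hq, rfl⟩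
      · exact Or.inl ⟨q, Ne.symm hq, Y, hY, rfl⟩
  refine ⟨_, (hg _).2 ⟨M.start, 0, h.zero_mem, fun h => absurd h hfs, ?_⟩, ?_, ?_⟩
  · simp [g, M.acceptsFromFinset_start]
  · refine (card_union_le _ _).trans (add_le_add ?_ ?_)
    · refine (card_image₂_le _ _ _).trans (Nat.mul_le_mul ?_ hu)
      rw [card_erase_of_mem (mem_univ f), card_univ]
    · exact (card_image₂_le _ _ _).trans (by simpa using hv)
  · intro X hX a
    obtain ⟨q, Y, hY, hqY, rfl⟩ := (hg X).1 hX
    refine (h.leftQuotient_mul_add hE hf {q} hY (by simpa using hqY) a).imp_left ?_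
    rintro ⟨Y', hY', hqY', heq⟩
    exact (hg _).2 ⟨M.step q a, Y', hY', by simpa using hqY', by simpa [g] using heq.symm⟩

theorem OneFinal.exists_mul {R L : Language σ} (hR : ∀ Z, Z * R ≤ R) {m : ℕ}
    (hL : OneFinal m L) :
    ∃ 𝒞 : Finset (Language σ), L * R ∈ 𝒞 ∧ #𝒞 ≤ m - 1 ∧
      ∀ X ∈ 𝒞, ∀ a, X.leftQuotient [a] ∈ 𝒞 ∨ X.leftQuotient [a] ∈ ({R} : Set (Language σ)) := by
  classical
  obtain ⟨Q, _, M, f, rfl, hf, hfs, rfl⟩ := hL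
  refine ⟨(univ.erase f).image fun q => M.acceptsFromFinset {q} * R, ?_, ?_, ?_⟩
  · exact mem_image.2 ⟨M.start, by simpa using hfs.symm, by rw [M.acceptsFromFinset_start]⟩
  · refine card_image_le.trans ?_
    rw [card_erase_of_mem (mem_univ f), card_univ]
  · simp only [forall_mem_image, mem_erase, mem_univ, and_true]
    intro q hq a
    refine (leftQuotient_acceptsFromFinset_mul hR hf (S := {q}) (by simpa using hq.symm) a).imp_left
      ?_
    rintro ⟨hfq, heq⟩
    rw [image_singleton] at hfq heq
    exact mem_image.2 ⟨M.step q a, by simpa [eq_comm] using hfq, heq.symm⟩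

theorem HasRestartFamily.exists_top_mul {N : Language σ} {b : ℕ × ℕ}
    (h : HasRestartFamily ∅ N b) :
    ∃ 𝒟 : Finset (Language σ), ⊤ * N ∈ 𝒟 ∧ #𝒟 ≤ b.2 ∧
      ∀ X ∈ 𝒟, ∀ a, X.leftQuotient [a] ∈ 𝒟 := by
  classical
  obtain ⟨𝒰, 𝒱, h, -, hv⟩ := h
  have hN : N ≤ ⊤ * N := le_mul_of_nil_mem (Set.mem_univ _)
  refine ⟨𝒱.image (⊤ * N + ·), ?_, card_image_le.trans hv, ?_⟩
  · exact mem_image.2 ⟨_, h.add_mem 0 h.zero_mem, by rw [zero_add, add_eq_left_iff_le.2 hN]⟩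
  · simp only [forall_mem_image]
    intro Y hY a
    have hYa := (h.leftQuotient_mem Y (h.subset hY) a).resolve_right (Set.notMem_empty _)
    refine mem_image.2 ⟨_, h.add_mem _ hYa, ?_⟩
    have htop : (⊤ : Language σ).leftQuotient [a] = ⊤ := rfl
    rw [Language.leftQuotient_mul_add fun _ => h.le_of_mem Y hY, htop, add_comm _ N, ← add_assoc,
      add_eq_left_iff_le.2 hN]

theorem acceptedByAtMost_of_closed_up_to {L R : Language σ} {𝒞 𝒟 : Finset (Language σ)} {c d : ℕ}
    (hL : L ∈ 𝒞) (hc : #𝒞 ≤ c)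
    (h𝒞 : ∀ X ∈ 𝒞, ∀ a, X.leftQuotient [a] ∈ 𝒞 ∨ X.leftQuotient [a] ∈ ({R} : Set (Language σ)))
    (hR : R ∈ 𝒟) (hd : #𝒟 ≤ d) (h𝒟 : ∀ X ∈ 𝒟, ∀ a, X.leftQuotient [a] ∈ 𝒟) :
    AcceptedByAtMost σ L (c + d) := by
  classical
  refine acceptedByAtMost_of_leftQuotient_mem (mem_union_left 𝒟 hL) ?_
    ((card_union_le _ _).trans (add_le_add hc hd))
  intro X hX a
  rcases mem_union.1 hX with hX | hX
  · rcases h𝒞 X hX a with h | h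
    · exact mem_union_left _ h
    · exact mem_union_right _ (h ▸ hR)
  · exact mem_union_right _ (h𝒟 X hX a)

theorem UV_cons {l : List ℕ} (hl : l ≠ []) (m : ℕ) :
    UV (m :: l) = (1 + (2 ^ (m - 1) - 1) * (UV l).1 + 2 ^ (m - 1) * (UV l).2,
      2 ^ (m - 2) * ((UV l).1 + (UV l).2)) := by
  cases l with
  | nil => exact absurd rfl hl
  | cons => rfl

theorem UV'_cons {l : List ℕ} (hl : l ≠ []) (m : ℕ) :
    UV' (m :: l) = (1 + (2 ^ (m - 1) - 1) * (UV' l).1 + 2 ^ (m - 1) * (UV' l).2,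
      2 ^ (m - 2) * ((UV' l).1 + (UV' l).2)) := by
  cases l with
  | nil => exact absurd rfl hl
  | cons => rfl

theorem hasRestartFamily_prod {Q : Type} [Fintype Q] (M : DFA σ Q) {ms : List ℕ}
    {Ls : List (Language σ)} (h : List.Forall₂ OneFinal ms Ls) :
    HasRestartFamily ∅ (Ls ++ [M.accepts]).prod (UV (ms ++ [Fintype.card Q])) := by
  induction h with
  | nil => simpa [UV] using hasRestartFamily_accepts M
  | cons hL _ ih =>
    rw [List.cons_append, List.cons_append, List.prod_cons, UV_cons (by simp)]
    exact ih.mul (fun _ _ hY => absurd hY (Set.notMem_empty _)) hL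

theorem hasRestartFamily_prod_mul {R : Language σ} (hR : ∀ Z, Z * R ≤ R) {ms : List ℕ}
    {Ls : List (Language σ)} (h : List.Forall₂ OneFinal ms Ls) (hms : ms ≠ []) :
    HasRestartFamily {R} (Ls.prod * R) (UV' ms) ∧ AbsorbsMul {R} (Ls.prod * R) := by
  refine ⟨?_, (absorbsMul_singleton hR).mul _⟩
  induction h with
  | nil => exact absurd rfl hms
  | @cons m L ms Ls hL hLs ih =>
    rw [List.prod_cons, mul_assoc]
    rcases eq_or_ne ms [] with rfl | hne
    · cases hLs
      simpa [UV'] using hasRestartFamily_mul hR hL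
    · rw [UV'_cons hne]
      exact (ih hne).mul ((absorbsMul_singleton hR).mul _) hL

/-- The number of states used before the first prefix in a product of languages of one-final DFAs
with `m :: ms` states is found. -/
def prefixBound (m : ℕ) (ms : List ℕ) : ℕ :=
  if ms = [] then m - 1 else (m - 1) * (UV' ms).1 + (UV' ms).2

theorem acceptedByAtMost_prod_mul {R : Language σ} (hR : ∀ Z, Z * R ≤ R) {m : ℕ} {L : Language σ}
    {ms : List ℕ} {Ls : List (Language σ)} (h : List.Forall₂ OneFinal (m :: ms) (L :: Ls))
    {𝒟 : Finset (Language σ)} {d : ℕ}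
    (hR𝒟 : R ∈ 𝒟) (hd : #𝒟 ≤ d) (h𝒟 : ∀ X ∈ 𝒟, ∀ a, X.leftQuotient [a] ∈ 𝒟) :
    AcceptedByAtMost σ ((L :: Ls).prod * R) (prefixBound m ms + d) := by
  obtain ⟨hL, hLs⟩ := List.forall₂_cons.1 h
  rw [List.prod_cons, mul_assoc, prefixBound]
  split_ifs with hms
  · subst hms
    cases hLs
    obtain ⟨𝒞, h₁, h₂, h₃⟩ := hL.exists_mul hR
    exact acceptedByAtMost_of_closed_up_to (by simpa using h₁) h₂ h₃ hR𝒟 hd h𝒟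
  · obtain ⟨hF, hE⟩ := hasRestartFamily_prod_mul hR hLs hms
    obtain ⟨𝒞, h₁, h₂, h₃⟩ := hF.exists_mul hE hL
    exact acceptedByAtMost_of_closed_up_to h₁ h₂ h₃ hR𝒟 hd h𝒟

namespace List

theorem drop_ofFn_eq_append {α : Type*} {k : ℕ} (f : Fin k → α) {a b : ℕ} (h : a + b + 1 = k) :
    (ofFn f).drop a = ((ofFn f).drop a).take b ++ [f ⟨a + b, h ▸ Nat.lt_succ_self _⟩] := by
  subst h
  conv_lhs => rw [← take_append_drop b ((ofFn f).drop a), drop_drop]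
  congr 1
  rw [drop_eq_getElem_cons (by simp), List.getElem_ofFn, drop_of_length_le (by simp)]

theorem take_ofFn_eq_cons {α : Type*} {k : ℕ} (f : Fin k → α) (hk : 0 < k) {j : ℕ} (hj : 1 ≤ j) :
    (ofFn f).take j = f ⟨0, hk⟩ :: ((ofFn f).drop 1).take (j - 1) := by
  obtain ⟨j, rfl⟩ := Nat.exists_eq_add_of_le' hj
  obtain ⟨k, rfl⟩ := Nat.exists_eq_succ_of_ne_zero hk.ne'
  simp [ofFn_succ]

theorem prod_ofFn_eq {α : Type*} [Monoid α] {k : ℕ} (f : Fin k → α) (j : Fin k) :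
    (ofFn f).prod = ((ofFn f).take j).prod * (f j * ((ofFn f).drop (j + 1)).prod) := by
  rw [← prod_take_mul_prod_drop (ofFn f) j, drop_eq_getElem_cons (by simp), prod_cons,
    List.getElem_ofFn]

theorem forall₂_take_drop_ofFn {α β : Type*} {r : α → β → Prop} {k : ℕ} {f : Fin k → α}
    {g : Fin k → β} {a b : ℕ} (h : ∀ i : Fin k, a ≤ i → i < a + b → r (f i) (g i)) :
    Forall₂ r (((ofFn f).drop a).take b) (((ofFn g).drop a).take b) := by
  refine forall₂_iff_get.2 ⟨by simp, fun i h₁ _ => ?_⟩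
  simp only [length_take, length_drop, length_ofFn] at h₁
  simpa using h ⟨a + i, by omega⟩ (by simp) (by simp; omega)

end List

end

/-- (Indices are 0-based: the 1-based index `j` of the statement corresponds to
`j.val + 1`; thus `j = 1` reads `j.val = 0`, `j = k` reads `j.val + 1 = k`, and
`2 ≤ j ≤ k−1` reads `1 ≤ j.val ∧ j.val + 2 ≤ k`.) -/
theorem stmt5 {σ : Type} (k : ℕ) (hk : 2 ≤ k) (j : Fin k) (n : Fin k → ℕ)
    (hnj : n j = 1) (hn : ∀ i, i ≠ j → 2 ≤ n i)
    (Q : Fin k → Type) [∀ i, Fintype (Q i)] (hcard : ∀ i, Fintype.card (Q i) = n i)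
    (A : ∀ i, DFA σ (Q i))
    (hAj : (A j).accept = Set.univ)
    (hone : ∀ i : Fin k, i.val + 1 < k → i ≠ j →
      ∃ f, (A i).accept = {f} ∧ f ≠ (A i).start) :
    (j.val = 0 →
      AcceptedByAtMost σ (List.ofFn fun i => (A i).accepts).prod
        (UV ((List.ofFn n).drop 1)).2) ∧
    (j.val + 1 = k ∧ k = 2 →
      AcceptedByAtMost σ (List.ofFn fun i => (A i).accepts).prod
        (n ⟨0, Nat.lt_of_lt_of_le Nat.zero_lt_two hk⟩)) ∧
    (j.val + 1 = k ∧ 3 ≤ k →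
      AcceptedByAtMost σ (List.ofFn fun i => (A i).accepts).prod
        ((n ⟨0, Nat.lt_of_lt_of_le Nat.zero_lt_two hk⟩ - 1) *
            (UV' (((List.ofFn n).drop 1).dropLast)).1
          + (UV' (((List.ofFn n).drop 1).dropLast)).2 + 1)) ∧
    (1 ≤ j.val → j.val + 2 ≤ k →
      AcceptedByAtMost σ (List.ofFn fun i => (A i).accepts).prod
        ((if j.val = 1 then n ⟨0, Nat.lt_of_lt_of_le Nat.zero_lt_two hk⟩ - 1
          else (n ⟨0, Nat.lt_of_lt_of_le Nat.zero_lt_two hk⟩ - 1) *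
              (UV' (((List.ofFn n).drop 1).take (j.val - 1))).1
            + (UV' (((List.ofFn n).drop 1).take (j.val - 1))).2)
          + (UV ((List.ofFn n).drop (j.val + 1))).2)) := by
  have h0 : 0 < k := by omega
  have hfin : ∀ i : Fin k, i.val + 1 < k → i ≠ j → OneFinal (n i) (A i).accepts := by
    intro i hi hij
    obtain ⟨f, hf, hfs⟩ := hone i hi hij
    exact ⟨Q i, inferInstance, A i, f, hcard i, hf, hfs, rfl⟩
  have htop : (A j).accepts = ⊤ := by
    ext w
    rw [DFA.mem_accepts, hAj]
    exact Iff.rfl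
  have hprod := List.prod_ofFn_eq (fun i => (A i).accepts) j
  rw [htop] at hprod
  have htail : j.val + 1 < k →
      HasRestartFamily ∅ ((List.ofFn fun i => (A i).accepts).drop (j + 1)).prod
        (UV ((List.ofFn n).drop (j + 1))) := by
    intro hj
    have hk' : j.val + 1 + (k - (j + 2)) + 1 = k := by omega
    rw [List.drop_ofFn_eq_append _ hk', List.drop_ofFn_eq_append n hk', ← hcard]
    refine hasRestartFamily_prod _ (List.forall₂_take_drop_ofFn fun i hi hi' => hfin i ?_ ?_)
    · omega
    · rintro rfl
      omega
  have hfront : 1 ≤ j.val → ∀ (𝒟 : Finset (Language σ)) (d : ℕ),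
      ⊤ * ((List.ofFn fun i => (A i).accepts).drop (j + 1)).prod ∈ 𝒟 → 𝒟.card ≤ d →
      (∀ X ∈ 𝒟, ∀ a, X.leftQuotient [a] ∈ 𝒟) →
      AcceptedByAtMost σ (List.ofFn fun i => (A i).accepts).prod
        (prefixBound (n ⟨0, h0⟩) (((List.ofFn n).drop 1).take (j - 1)) + d) := by
    intro hj 𝒟 d hmem hd h𝒟
    rw [hprod, List.take_ofFn_eq_cons _ h0 hj]
    refine acceptedByAtMost_prod_mul (fun Z => Language.mul_top_mul_le Z _)
      (List.Forall₂.cons (hfin _ ?_ ?_) (List.forall₂_take_drop_ofFn fun i hi hi' => hfin i ?_ ?_))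
      hmem hd h𝒟
    · exact hk
    · rintro rfl
      exact absurd hj (by simp)
    · omega
    · rintro rfl
      omega
  have hlast : 1 ≤ j.val → j.val + 1 = k →
      AcceptedByAtMost σ (List.ofFn fun i => (A i).accepts).prod
        (prefixBound (n ⟨0, h0⟩) (((List.ofFn n).drop 1).take (j - 1)) + 1) := by
    intro hj hjk
    refine hfront hj {⊤} 1 ?_ (by simp) ?_
    · rw [List.drop_of_length_le (by simp [hjk])]
      simp
    · intro X hX a
      rw [Finset.mem_singleton.1 hX]
      exact Finset.mem_singleton_self _
  refine ⟨fun hj => ?_, ?_, ?_, fun hj hjk => ?_⟩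
  · have h := htail (by omega)
    simp only [hj, List.take_zero, List.prod_nil, one_mul] at h hprod
    obtain ⟨𝒟, hmem, hd, h𝒟⟩ := h.exists_top_mul
    rw [hprod]
    exact acceptedByAtMost_of_leftQuotient_mem hmem h𝒟 hd
  · rintro ⟨hjk, hk2⟩
    have hj : j.val = 1 := by omega
    have hn0 := hn ⟨0, h0⟩ fun h => by simp [← h] at hj
    have h := hlast hj.ge hjk
    simp only [hj, Nat.sub_self, List.take_zero, prefixBound, if_true] at h
    rwa [Nat.sub_add_cancel (by omega)] at h
  · rintro ⟨hjk, hk3⟩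
    have hne : ((List.ofFn n).drop 1).take (j - 1) ≠ [] := by
      rw [← List.length_pos_iff]
      simp only [List.length_take, List.length_drop, List.length_ofFn]
      omega
    have hdl : ((List.ofFn n).drop 1).dropLast = ((List.ofFn n).drop 1).take (j - 1) := by
      rw [List.dropLast_eq_take, List.length_drop, List.length_ofFn]
      congr 1
      omega
    have h := hlast (by omega) hjk
    rwa [prefixBound, if_neg hne, ← hdl] at h
  · have hnil : ((List.ofFn n).drop 1).take (j - 1) = [] ↔ j.val = 1 := by
      rw [← List.length_eq_zero_iff]
      simp only [List.length_take, List.length_drop, List.length_ofFn]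
      omega
    obtain ⟨𝒟, hmem, hd, h𝒟⟩ := (htail (by omega)).exists_top_mul
    have h := hfront hj 𝒟 _ hmem hd h𝒟
    simpa only [prefixBound, hnil] using h
end

section
/- For every k ≥ 2 and all integers n₁,…,n_k ≥ 2, there exist languages L₁,…,L_k over an alphabet with k+1 letters such that each L_i is accepted by a DFA with n_i states, while every DFA accepting the concatenation L₁L₂⋯L_k has at least B(n₁,…,n_k) states. -/
/-- `B(n₁,…,n_k) = (n₁−1)·U₂ + V₂`, where `rest = [n₂,…,n_k]`. -/
def Bval (n1 : ℕ) (rest : List ℕ) : ℕ := (n1 - 1) * (UV rest).1 + (UV rest).2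

namespace MultiConcat

/-- Cyclic successor on `{0, …, m - 1}`. -/
def rot (m q : ℕ) : ℕ := if q + 1 = m then 0 else q + 1

/-- Transition function of the `j`-th witness automaton, with states `{0, …, n j - 1}`, on letter
`l`. Letter `j` is a cyclic shift. If `k + j` is odd, letter `k` sends `0` to `1`; otherwise letter
`j + 1` sends the last state to `0`. All other letters act as the identity. -/
def trans (k : ℕ) (n : ℕ → ℕ) (j l q : ℕ) : ℕ :=
  if l = j then rot (n j) q
  else if (k + j) % 2 = 1 then (if l = k ∧ q = 0 then 1 else q)
  else (if l = j + 1 ∧ q + 1 = n j then 0 else q)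

/-- Step of the subset automaton of the concatenation: each component is a set of states of one
witness automaton. -/
def move (k : ℕ) (n : ℕ → ℕ) (S : ℕ → Finset ℕ) (l : ℕ) : ℕ → Finset ℕ := fun j =>
  (S j).image (trans k n j l) ∪
    if 0 < j ∧ j < k ∧ n (j - 1) - 1 ∈ (S (j - 1)).image (trans k n (j - 1) l) then {0} else ∅

def initConf : ℕ → Finset ℕ := fun j => if j = 0 then {0} else ∅

/-- The configuration reached from `S` after reading `w`. -/
def run (k : ℕ) (n : ℕ → ℕ) (S : ℕ → Finset ℕ) (w : List (Fin (k + 1))) : ℕ → Finset ℕ :=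
  w.foldl (fun S a => move k n S a) S

def evalFrom (k : ℕ) (n : ℕ → ℕ) (j q : ℕ) (w : List (Fin (k + 1))) : ℕ :=
  w.foldl (fun q a => trans k n j a q) q

/-- The language of the `j`-th witness automaton. -/
def lang (k : ℕ) (n : ℕ → ℕ) (j : ℕ) : Language (Fin (k + 1)) :=
  {w | evalFrom k n j 0 w = n j - 1}

def prefixProd (k : ℕ) (n : ℕ → ℕ) (j : ℕ) : Language (Fin (k + 1)) :=
  ((List.range j).map (lang k n)).prod

theorem mem_lang {k : ℕ} {n : ℕ → ℕ} {j : ℕ} {w : List (Fin (k + 1))} :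
    w ∈ lang k n j ↔ evalFrom k n j 0 w = n j - 1 := Iff.rfl

theorem prefixProd_succ (k : ℕ) (n : ℕ → ℕ) (j : ℕ) :
    prefixProd k n (j + 1) = prefixProd k n j * lang k n j := by
  simp [prefixProd, List.prod_range_succ]

theorem trans_lt {k : ℕ} {n : ℕ → ℕ} (hn : ∀ j, 2 ≤ n j) (j l : ℕ) {q : ℕ} (hq : q < n j) :
    trans k n j l q < n j := by
  have := hn j
  unfold trans rot
  split_ifs <;> omega

theorem mem_move {k : ℕ} {n : ℕ → ℕ} {S : ℕ → Finset ℕ} {l j q : ℕ} :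
    q ∈ move k n S l j ↔ (∃ p ∈ S j, trans k n j l p = q) ∨
      (q = 0 ∧ 0 < j ∧ j < k ∧ ∃ p ∈ S (j - 1), trans k n (j - 1) l p = n (j - 1) - 1) := by
  unfold move
  by_cases h : 0 < j ∧ j < k ∧ n (j - 1) - 1 ∈ (S (j - 1)).image (trans k n (j - 1) l)
  · rw [if_pos h]
    simp only [Finset.mem_image] at h
    simp only [Finset.mem_union, Finset.mem_image, Finset.mem_singleton]
    exact or_congr_right ⟨fun hq => ⟨hq, h⟩, fun hq => hq.1⟩
  · rw [if_neg h]
    simp only [Finset.mem_image] at h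
    simp only [Finset.mem_union, Finset.mem_image, Finset.notMem_empty]
    exact or_congr_right ⟨False.elim, fun hq => h hq.2⟩

theorem mem_run_init {k : ℕ} {n : ℕ → ℕ} (hn : ∀ j, 2 ≤ n j) (w : List (Fin (k + 1))) :
    ∀ j < k, ∀ q, q ∈ run k n initConf w j ↔
      ∃ u v, w = u ++ v ∧ u ∈ prefixProd k n j ∧ evalFrom k n j 0 v = q := by
  have hnil : ∀ j, ([] : List (Fin (k + 1))) ∉ lang k n j := by
    intro j h
    have := hn j
    change 0 = n j - 1 at h
    omega
  induction w using List.reverseRecOn with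
  | nil =>
    intro j _ q
    change q ∈ (if j = 0 then ({0} : Finset ℕ) else ∅) ↔ _
    cases j with
    | zero =>
      simp [prefixProd, evalFrom, Language.mem_one, eq_comm]
    | succ j =>
      simp only [Nat.add_eq_zero_iff, one_ne_zero, and_false, if_false, Finset.notMem_empty,
        false_iff]
      rintro ⟨u, v, huv, hu, -⟩
      obtain ⟨rfl, rfl⟩ := List.append_eq_nil_iff.1 huv.symm
      rw [prefixProd_succ, Language.mem_mul] at hu
      obtain ⟨a, _, b, hb, hab⟩ := hu
      obtain ⟨rfl, rfl⟩ := List.append_eq_nil_iff.1 hab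
      exact hnil j hb
  | append_singleton w a ih =>
    intro j hj q
    have hrun : run k n initConf (w ++ [a]) = move k n (run k n initConf w) a := by
      simp [run]
    have heval : ∀ j q v, evalFrom k n j q (v ++ [a]) = trans k n j a (evalFrom k n j q v) := by
      simp [evalFrom]
    rw [hrun, mem_move]
    constructor
    · rintro (⟨p, hp, rfl⟩ | ⟨rfl, h0, -, p, hp, hpl⟩)
      · obtain ⟨u, v, rfl, hu, rfl⟩ := (ih j hj p).1 hp
        exact ⟨u, v ++ [a], by simp, hu, heval _ _ _⟩
      · obtain ⟨i, rfl⟩ : ∃ i, j = i + 1 := ⟨j - 1, by omega⟩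
        simp only [Nat.add_sub_cancel] at hp hpl
        obtain ⟨u, v, rfl, hu, rfl⟩ := (ih i (by omega) p).1 hp
        refine ⟨u ++ v ++ [a], [], by simp, ?_, rfl⟩
        rw [prefixProd_succ, Language.mem_mul]
        exact ⟨u, hu, v ++ [a], by rw [mem_lang, heval, hpl], by simp⟩
    · rintro ⟨u, v, huv, hu, rfl⟩
      rcases List.eq_nil_or_concat' v with rfl | ⟨v, b, rfl⟩
      · right
        simp only [List.append_nil] at huv
        subst huv
        cases j with
        | zero => simp [prefixProd, Language.mem_one] at hu
        | succ i =>
          rw [prefixProd_succ, Language.mem_mul] at hu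
          obtain ⟨x, hx, y, hy, hxy⟩ := hu
          rcases List.eq_nil_or_concat' y with rfl | ⟨y, b, rfl⟩
          · exact absurd hy (hnil i)
          rw [← List.append_assoc] at hxy
          obtain ⟨rfl, hb⟩ := List.append_inj' hxy rfl
          obtain rfl : b = a := by simpa using hb
          refine ⟨rfl, by omega, hj, evalFrom k n i 0 y, ?_, ?_⟩
          · exact (ih i (by omega) _).2 ⟨x, y, rfl, hx, rfl⟩
          · rw [mem_lang, heval] at hy
            exact hy
      · left
        rw [← List.append_assoc] at huv
        obtain ⟨rfl, hb⟩ := List.append_inj' huv rfl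
        obtain rfl : a = b := by simpa using hb
        exact ⟨_, (ih j hj _).2 ⟨u, v, rfl, hu, rfl⟩, (heval _ _ _).symm⟩

theorem mem_prefixProd_iff {k : ℕ} {n : ℕ → ℕ} (hn : ∀ j, 2 ≤ n j) (hk : 0 < k)
    (w : List (Fin (k + 1))) :
    w ∈ prefixProd k n k ↔ n (k - 1) - 1 ∈ run k n initConf w (k - 1) := by
  obtain ⟨j, rfl⟩ : ∃ j, k = j + 1 := ⟨k - 1, by omega⟩
  rw [mem_run_init hn w _ (by omega), prefixProd_succ, Language.mem_mul]
  constructor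
  · rintro ⟨u, hu, v, hv, rfl⟩
    exact ⟨u, v, rfl, hu, hv⟩
  · rintro ⟨u, v, rfl, hu, hv⟩
    exact ⟨u, hu, v, hv, rfl⟩

/-! ### Distinguishability -/

def Distinguishable (k : ℕ) (n : ℕ → ℕ) (S T : ℕ → Finset ℕ) : Prop :=
  ∃ w, ¬(n (k - 1) - 1 ∈ run k n S w (k - 1) ↔ n (k - 1) - 1 ∈ run k n T w (k - 1))

theorem Distinguishable.of_move {k : ℕ} {n : ℕ → ℕ} {S T : ℕ → Finset ℕ} {l : ℕ} (hl : l ≤ k)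
    (h : Distinguishable k n (move k n S l) (move k n T l)) : Distinguishable k n S T := by
  obtain ⟨w, hw⟩ := h
  exact ⟨⟨l, by omega⟩ :: w, hw⟩

/-- Distinguishing a state in a component reduces to distinguishing the final state. -/
theorem distinguishable_of_last {k : ℕ} {n : ℕ → ℕ} {i : ℕ} (hi : i < k)
    (hlast : ∀ S T : ℕ → Finset ℕ, n i - 1 ∈ S i → n i - 1 ∉ T i → Distinguishable k n S T)
    (m : ℕ) : ∀ (S T : ℕ → Finset ℕ) (q : ℕ), q + m + 1 = n i → q ∈ S i → q ∉ T i →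
      Distinguishable k n S T := by
  induction m with
  | zero =>
    intro S T q hq hS hT
    obtain rfl : q = n i - 1 := by omega
    exact hlast S T hS hT
  | succ m ih =>
    intro S T q hq hS hT
    refine Distinguishable.of_move hi.le (ih _ _ (q + 1) (by omega) ?_ ?_)
    · exact mem_move.2 (Or.inl ⟨q, hS, by simp only [trans, rot]; split_ifs <;> omega⟩)
    · rw [mem_move]
      rintro (⟨p, hp, h⟩ | h)
      · simp only [trans, rot, if_true] at h
        split_ifs at h
        obtain rfl : p = q := by omega
        exact hT hp
      · omega

theorem distinguishable_of_mem_of_notMem {k : ℕ} {n : ℕ → ℕ} (hn : ∀ j, 2 ≤ n j) (d : ℕ) :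
    ∀ (i : ℕ), i + d + 1 = k → ∀ (S T : ℕ → Finset ℕ) (q : ℕ), q < n i → q ∈ S i → q ∉ T i →
      Distinguishable k n S T := by
  induction d with
  | zero =>
    intro i hi S T q hq
    refine distinguishable_of_last (by omega) ?_ (n i - 1 - q) S T q (by omega)
    intro S T hS hT
    refine ⟨[], fun h => hT ?_⟩
    obtain rfl : i = k - 1 := by omega
    exact h.1 hS
  | succ d ih =>
    intro i hi S T q hq
    refine distinguishable_of_last (by omega) ?_ (n i - 1 - q) S T q (by omega)
    intro S T hS hT
    have hni := hn i
    have hni' := hn (i + 1)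
    by_cases hpar : (k + (i + 1)) % 2 = 1
    · refine Distinguishable.of_move le_rfl (ih (i + 1) (by omega) _ _ 0 (by omega) ?_ ?_)
      · refine mem_move.2 (Or.inr ⟨rfl, by omega, by omega, n i - 1, hS, ?_⟩)
        simp only [Nat.add_sub_cancel, trans]
        split_ifs <;> omega
      · rw [mem_move]
        rintro (⟨p, hp, h⟩ | ⟨-, -, -, p, hp, h⟩)
        · simp only [trans, true_and] at h
          split_ifs at h <;> omega
        · simp only [Nat.add_sub_cancel, trans] at h hp
          have : p = n i - 1 := by split_ifs at h <;> omega
          exact hT (this ▸ hp)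
    · refine Distinguishable.of_move (l := i + 2) (by omega)
        (Distinguishable.of_move (l := i + 1) (by omega)
          (ih (i + 1) (by omega) _ _ 0 (by omega) ?_ ?_))
      · refine mem_move.2 (Or.inr ⟨rfl, by omega, by omega, n i - 1,
          mem_move.2 (Or.inl ⟨n i - 1, hS, ?_⟩), ?_⟩)
        all_goals
          simp only [Nat.add_sub_cancel, trans]
          split_ifs <;> omega
      · have hT1 : n i - 1 ∉ move k n T (i + 2) i := by
          rw [mem_move]
          rintro (⟨p, hp, h⟩ | h)
          · simp only [trans] at h
            have : p = n i - 1 := by split_ifs at h <;> omega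
            exact hT (this ▸ hp)
          · omega
        have hT2 : n (i + 1) - 1 ∉ move k n T (i + 2) (i + 1) := by
          rw [mem_move]
          rintro (⟨p, hp, h⟩ | h)
          · simp only [trans, true_and] at h
            split_ifs at h <;> omega
          · omega
        rw [mem_move]
        rintro (⟨p, hp, h⟩ | ⟨-, -, -, p, hp, h⟩)
        · simp only [trans, rot, if_true] at h
          have : p = n (i + 1) - 1 := by split_ifs at h; omega
          exact hT2 (this ▸ hp)
        · simp only [Nat.add_sub_cancel, trans] at h hp
          have : p = n i - 1 := by split_ifs at h <;> omega
          exact hT1 (this ▸ hp)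

/-! ### Reachability -/

def Reachable (k : ℕ) (n : ℕ → ℕ) (S : ℕ → Finset ℕ) : Prop := ∃ w, run k n initConf w = S

theorem Reachable.move {k : ℕ} {n : ℕ → ℕ} {S : ℕ → Finset ℕ} (h : Reachable k n S) {l : ℕ}
    (hl : l ≤ k) : Reachable k n (move k n S l) := by
  obtain ⟨w, rfl⟩ := h
  exact ⟨w ++ [⟨l, by omega⟩], by simp [run]⟩

/-- The configuration with components `{0}` before `i`, `X` at `i`, and those of `T` after `i`. -/
def glue (i : ℕ) (X : Finset ℕ) (T : ℕ → Finset ℕ) : ℕ → Finset ℕ := fun j =>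
  if j < i then {0} else if j = i then X else T j

/-- From component `i` on, a final state in one component forces the initial state in the next. -/
def ClosedFrom (k : ℕ) (n : ℕ → ℕ) (i : ℕ) (T : ℕ → Finset ℕ) : Prop :=
  ∀ j, i ≤ j → j + 1 < k → n j - 1 ∈ T j → 0 ∈ T (j + 1)

theorem ClosedFrom.mono {k : ℕ} {n : ℕ → ℕ} {i i' : ℕ} {T : ℕ → Finset ℕ}
    (h : ClosedFrom k n i T) (hi : i ≤ i') : ClosedFrom k n i' T :=
  fun j hj => h j (hi.trans hj)

theorem move_glue {k : ℕ} {n : ℕ → ℕ} (hn : ∀ j, 2 ≤ n j) {i : ℕ} (hi : i < k) (X : Finset ℕ)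
    {T : ℕ → Finset ℕ} (hT : ClosedFrom k n (i + 1) T) :
    move k n (glue i X T) i = glue i (X.image (rot (n i)))
      (if n i - 1 ∈ X.image (rot (n i)) ∧ i + 1 < k
        then Function.update T (i + 1) (insert 0 (T (i + 1))) else T) := by
  have hlow : ∀ j < i, trans k n j i 0 = 0 := by
    intro j hj
    have := hn j
    unfold trans
    split_ifs <;> omega
  have hself : trans k n i i = rot (n i) := by
    funext q
    simp [trans]
  have hhigh : ∀ j, i < j → trans k n j i = id := by
    intro j hj
    funext q
    simp only [trans, id]
    split_ifs <;> omega
  funext j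
  rcases lt_trichotomy j i with hj | rfl | hj
  · have h1 : glue i X T j = {0} := if_pos hj
    have h2 : glue i X T (j - 1) = {0} := if_pos (by omega)
    have h3 : ¬ (0 < j ∧ j < k ∧ n (j - 1) - 1 ∈
        (glue i X T (j - 1)).image (trans k n (j - 1) i)) := by
      rw [h2, Finset.image_singleton, hlow _ (by omega), Finset.mem_singleton]
      have := hn (j - 1)
      omega
    rw [move, if_neg h3, h1, Finset.image_singleton, hlow _ hj, Finset.union_empty]
    exact (if_pos hj).symm
  · have h1 : glue j X T j = X := by simp [glue]
    have h3 : ¬ (0 < j ∧ j < k ∧ n (j - 1) - 1 ∈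
        (glue j X T (j - 1)).image (trans k n (j - 1) j)) := by
      rintro ⟨h0, -, h⟩
      have h2 : glue j X T (j - 1) = {0} := if_pos (by omega)
      rw [h2, Finset.image_singleton, hlow _ (by omega), Finset.mem_singleton] at h
      have := hn (j - 1)
      omega
    rw [move, if_neg h3, h1, hself, Finset.union_empty]
    simp [glue]
  · have h1 : ∀ Y T', glue i Y T' j = T' j := fun Y T' => by
      simp [glue, hj.ne', hj.le]
    rw [move, h1, h1, hhigh j hj, Finset.image_id]
    obtain rfl | hj' : j = i + 1 ∨ i + 1 < j := by omega
    · have h2 : glue i X T i = X := by simp [glue]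
      simp only [Nat.add_sub_cancel, h2, hself]
      by_cases hc : n i - 1 ∈ X.image (rot (n i)) ∧ i + 1 < k
      · rw [if_pos hc, if_pos ⟨by omega, hc.2, hc.1⟩, Function.update_self, Finset.union_comm]
        rfl
      · rw [if_neg hc, if_neg (fun h => hc ⟨h.2.2, h.2.1⟩), Finset.union_empty]
    · have h2 : glue i X T (j - 1) = T (j - 1) := by
        simp only [glue]
        rw [if_neg (by omega), if_neg (by omega)]
      rw [h2, hhigh _ (by omega), Finset.image_id]
      have h3 : (if n i - 1 ∈ X.image (rot (n i)) ∧ i + 1 < k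
          then Function.update T (i + 1) (insert 0 (T (i + 1))) else T) j = T j := by
        split_ifs
        · exact Function.update_of_ne (by omega) _ _
        · rfl
      rw [h3]
      split_ifs with hc
      · have := hT (j - 1) (by omega) (by omega) hc.2.2
        rw [Nat.sub_add_cancel (by omega)] at this
        simpa using this
      · simp

theorem Reachable.shift {k : ℕ} {n : ℕ → ℕ} (hn : ∀ j, 2 ≤ n j) {i : ℕ} (hi : i < k)
    {X : Finset ℕ} {T : ℕ → Finset ℕ} (hT : ClosedFrom k n (i + 1) T)
    (hX : n i - 1 ∈ X.image (rot (n i)) → i + 1 < k → 0 ∈ T (i + 1))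
    (h : Reachable k n (glue i X T)) : Reachable k n (glue i (X.image (rot (n i))) T) := by
  have := h.move hi.le
  rw [move_glue hn hi X hT] at this
  split_ifs at this with hc
  · rwa [Finset.insert_eq_of_mem (hX hc.1 hc.2), Function.update_eq_self] at this
  · exact this

theorem rot_of_lt {m q : ℕ} (h : q + 1 < m) : rot m q = q + 1 := if_neg h.ne

theorem Reachable.shift_zero {k : ℕ} {n : ℕ → ℕ} (hn : ∀ j, 2 ≤ n j) {i : ℕ} (hi : i < k)
    {T : ℕ → Finset ℕ} (hT : ClosedFrom k n (i + 1) T) (h : Reachable k n (glue i {0} T))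
    (q : ℕ) (hq : q < n i) (hl : q = n i - 1 → i + 1 < k → 0 ∈ T (i + 1)) :
    Reachable k n (glue i {q} T) := by
  induction q with
  | zero => exact h
  | succ q ih =>
    have := (ih (by omega) (by omega)).shift hn hi hT
    rw [Finset.image_singleton, rot_of_lt hq] at this
    exact this fun h => hl (Finset.mem_singleton.1 h).symm

theorem glue_succ (i : ℕ) (X : Finset ℕ) (T : ℕ → Finset ℕ) :
    glue (i + 1) X T = glue i {0} (Function.update T (i + 1) X) := by
  funext j
  simp only [glue, Function.update_apply]
  split_ifs <;> first | rfl | omega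

theorem Reachable.insert_zero {k : ℕ} {n : ℕ → ℕ} (hn : ∀ j, 2 ≤ n j) {i : ℕ} (hi : i + 1 < k)
    {X : Finset ℕ} {T : ℕ → Finset ℕ} (hT : ClosedFrom k n (i + 2) T)
    (hX : n (i + 1) - 1 ∈ X → i + 2 < k → 0 ∈ T (i + 2))
    (h : Reachable k n (glue (i + 1) X T)) : Reachable k n (glue (i + 1) (insert 0 X) T) := by
  have hni := hn i
  have hcl : ∀ Y : Finset ℕ, (n (i + 1) - 1 ∈ Y → i + 2 < k → 0 ∈ T (i + 2)) →
      ClosedFrom k n (i + 1) (Function.update T (i + 1) Y) := by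
    intro Y hY j hj hjk hmem
    rw [Function.update_of_ne (by omega)]
    obtain rfl | hj' : j = i + 1 ∨ i + 2 ≤ j := by omega
    · rw [Function.update_self] at hmem
      exact hY hmem hjk
    · rw [Function.update_of_ne (by omega)] at hmem
      exact hT j hj' hjk hmem
  have hX' : n (i + 1) - 1 ∈ insert 0 X → i + 2 < k → 0 ∈ T (i + 2) := by
    intro h
    have := hn (i + 1)
    rcases Finset.mem_insert.1 h with h | h
    · omega
    · exact hX h
  rw [glue_succ] at h ⊢
  have h1 := (h.shift_zero hn (by omega) (hcl X hX) (n i - 2) (by omega) (by omega)).move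
    (l := i) (by omega)
  have hr : rot (n i) (n i - 2) = n i - 1 := by
    rw [rot_of_lt (by omega)]
    omega
  rw [move_glue hn (by omega) _ (hcl X hX), Finset.image_singleton, hr,
    if_pos ⟨Finset.mem_singleton_self _, hi⟩, Function.update_self, Function.update_idem] at h1
  have hr' : rot (n i) (n i - 1) = 0 := if_pos (by omega)
  have h2 := h1.shift hn (by omega) (hcl _ hX') (fun _ _ => by simp)
  rwa [Finset.image_singleton, hr'] at h2

theorem Reachable.build {k : ℕ} {n : ℕ → ℕ} (hn : ∀ j, 2 ≤ n j) {i : ℕ} (hi : i + 1 < k)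
    {T : ℕ → Finset ℕ} (hT : ClosedFrom k n (i + 2) T)
    (h : Reachable k n (glue (i + 1) {0} T)) (m : ℕ) (hm : m ≤ n (i + 1)) :
    ∀ X : Finset ℕ, X.Nonempty → X ⊆ Finset.range m →
      (n (i + 1) - 1 ∈ X → i + 2 < k → 0 ∈ T (i + 2)) → Reachable k n (glue (i + 1) X T) := by
  induction m with
  | zero =>
    intro X hne hX
    simp only [Finset.range_zero, Finset.subset_empty] at hX
    simp [hX] at hne
  | succ m ih =>
    intro X hne hX hl
    have hni := hn (i + 1)
    have hlt : ∀ x ∈ X, x < m + 1 := fun x hx => Finset.mem_range.1 (hX hx)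
    have herase : ∀ x, x ∈ X.erase 0 → ∃ y, x = y + 1 ∧ y < m ∧ y + 1 ∈ X := by
      intro x hx
      obtain ⟨h0, hx⟩ := Finset.mem_erase.1 hx
      have := hlt x hx
      exact ⟨x - 1, by omega, by omega, by rwa [Nat.sub_add_cancel (by omega)]⟩
    have key : (X.erase 0).Nonempty → Reachable k n (glue (i + 1) (X.erase 0) T) := by
      intro hne'
      have himg : ((X.erase 0).image Nat.pred).image (rot (n (i + 1))) = X.erase 0 := by
        rw [Finset.image_image]
        conv_rhs => rw [← Finset.image_id (s := X.erase 0)]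
        refine Finset.image_congr fun x hx => ?_
        obtain ⟨y, rfl, hy, -⟩ := herase x hx
        exact rot_of_lt (show y + 1 < _ by omega)
      have := (ih (by omega) ((X.erase 0).image Nat.pred) (hne'.image _) ?_ ?_).shift hn hi hT
      · rw [himg] at this
        exact this fun h => hl (Finset.mem_of_mem_erase h)
      · intro x hx
        obtain ⟨x', hx', rfl⟩ := Finset.mem_image.1 hx
        obtain ⟨y, rfl, hy, -⟩ := herase x' hx'
        exact Finset.mem_range.2 hy
      · intro hx
        obtain ⟨x', hx', hxx⟩ := Finset.mem_image.1 hx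
        obtain ⟨y, rfl, hy, -⟩ := herase x' hx'
        simp only [Nat.pred_succ] at hxx
        omega
    by_cases h0 : 0 ∈ X
    · by_cases hne' : (X.erase 0).Nonempty
      · have := (key hne').insert_zero hn hi hT fun h => hl (Finset.mem_of_mem_erase h)
        rwa [Finset.insert_erase h0] at this
      · rw [Finset.not_nonempty_iff_eq_empty] at hne'
        rwa [← Finset.insert_erase h0, hne']
    · rw [Finset.erase_eq_of_notMem h0] at key
      exact key hne

theorem reachable_glue_empty {k : ℕ} {n : ℕ → ℕ} (hn : ∀ j, 2 ≤ n j) (i : ℕ) (hi : i < k) :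
    Reachable k n (glue i {0} fun _ => ∅) := by
  have hcl : ∀ i, ClosedFrom k n i fun _ => ∅ := fun i j _ _ h => by simp at h
  induction i with
  | zero => exact ⟨[], by funext j; simp [run, initConf, glue]⟩
  | succ i ih =>
    have h := ih (by omega)
    have h' : Reachable k n (glue (i + 1) ∅ fun _ => ∅) := by
      rw [glue_succ]
      convert h using 2
      exact Function.update_eq_self (i + 1) fun _ => ∅
    exact h'.insert_zero hn hi (hcl _) (by simp)

/-- The invariants of reachable configurations, apart from the first component being a singleton. -/
structure Valid (k : ℕ) (n : ℕ → ℕ) (S : ℕ → Finset ℕ) : Prop where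
  subset_range : ∀ j, S j ⊆ Finset.range (n j)
  eq_empty : ∀ j, k ≤ j → S j = ∅
  succ_eq_empty : ∀ j, S j = ∅ → S (j + 1) = ∅
  closed : ClosedFrom k n 0 S

theorem Valid.eq_empty_of_le {k : ℕ} {n : ℕ → ℕ} {S : ℕ → Finset ℕ} (h : Valid k n S) {i j : ℕ}
    (hij : i ≤ j) (hi : S i = ∅) : S j = ∅ := by
  induction j, hij using Nat.le_induction with
  | base => exact hi
  | succ j _ ih => exact h.succ_eq_empty j ih

theorem Valid.reachable_glue {k : ℕ} {n : ℕ → ℕ} (hn : ∀ j, 2 ≤ n j) {S : ℕ → Finset ℕ}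
    (hS : Valid k n S) (d : ℕ) :
    ∀ i, i + d + 1 = k → Reachable k n (glue i {0} S) := by
  have hempty : ∀ i < k, S (i + 1) = ∅ → Reachable k n (glue i {0} S) := by
    intro i hi h
    convert reachable_glue_empty hn i hi using 1
    funext j
    simp only [glue]
    split_ifs
    · rfl
    · rfl
    · exact hS.eq_empty_of_le (by omega) h
  induction d with
  | zero => exact fun i hi => hempty i (by omega) (hS.eq_empty _ (by omega))
  | succ d ih =>
    intro i hi
    rcases (S (i + 1)).eq_empty_or_nonempty with h | h
    · exact hempty i (by omega) h
    · have := (ih (i + 1) (by omega)).build hn (by omega) (hS.closed.mono (Nat.zero_le _))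
        (n (i + 1)) le_rfl (S (i + 1)) h (hS.subset_range _)
        (fun h hk => hS.closed (i + 1) (Nat.zero_le _) hk h)
      rwa [glue_succ, Function.update_eq_self] at this

theorem Valid.reachable {k : ℕ} {n : ℕ → ℕ} (hn : ∀ j, 2 ≤ n j) (hk : 0 < k) {S : ℕ → Finset ℕ}
    (hS : Valid k n S) {q : ℕ} (hq : S 0 = {q}) : Reachable k n S := by
  have hmem : q ∈ S 0 := by simp [hq]
  have := (hS.reachable_glue hn (k - 1) 0 (by omega)).shift_zero hn hk
    (hS.closed.mono (Nat.zero_le _)) q (Finset.mem_range.1 (hS.subset_range 0 hmem))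
    (fun h h1 => hS.closed 0 le_rfl h1 (h ▸ hmem))
  convert this using 1
  funext j
  cases j with
  | zero => simp [glue, hq]
  | succ j => simp [glue]

theorem Valid.distinguishable {k : ℕ} {n : ℕ → ℕ} (hn : ∀ j, 2 ≤ n j) {S T : ℕ → Finset ℕ}
    (hS : Valid k n S) (hT : Valid k n T) (hne : S ≠ T) : Distinguishable k n S T := by
  obtain ⟨j, hj⟩ := Function.ne_iff.1 hne
  have hjk : j < k := by
    by_contra h
    exact hj (by rw [hS.eq_empty j (by omega), hT.eq_empty j (by omega)])
  obtain ⟨q, hq⟩ : ∃ q, ¬(q ∈ S j ↔ q ∈ T j) := by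
    by_contra! h
    exact hj (Finset.ext h)
  by_cases hqS : q ∈ S j
  · exact distinguishable_of_mem_of_notMem hn (k - 1 - j) j (by omega) S T q
      (Finset.mem_range.1 (hS.subset_range j hqS)) hqS (by tauto)
  · have hqT : q ∈ T j := by tauto
    obtain ⟨w, hw⟩ := distinguishable_of_mem_of_notMem (k := k) hn (k - 1 - j) j (by omega) T S q
      (Finset.mem_range.1 (hT.subset_range j hqT)) hqT hqS
    exact ⟨w, fun h => hw h.symm⟩

/-! ### Counting -/

theorem UV_cons {m : ℕ} (hm : 2 ≤ m) (r : List ℕ) :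
    UV (m :: r) = (1 + (2 ^ (m - 1) - 1) * (UV r).1 + 2 ^ (m - 1) * (UV r).2,
      2 ^ (m - 2) * ((UV r).1 + (UV r).2)) := by
  cases r with
  | cons a r => rfl
  | nil =>
    obtain ⟨m, rfl⟩ : ∃ i, m = i + 2 := ⟨m - 2, by omega⟩
    have := Nat.one_le_two_pow (n := m + 1)
    simp only [UV, Nat.add_sub_cancel, show m + 2 - 1 = m + 1 by omega, Prod.mk.injEq]
    constructor
    · rw [pow_succ 2 (m + 1)]
      omega
    · rw [pow_succ]

/-- Prepend a component to a configuration. -/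
def consConf (p : Finset ℕ × (ℕ → Finset ℕ)) : ℕ → Finset ℕ
  | 0 => p.1
  | j + 1 => p.2 j

theorem consConf_injective : Function.Injective consConf := by
  rintro ⟨X, f⟩ ⟨Y, g⟩ h
  exact Prod.ext (congrFun h 0) (funext fun j => congrFun h (j + 1))

theorem Valid.consConf {k : ℕ} {n : ℕ → ℕ} {X : Finset ℕ} {f : ℕ → Finset ℕ}
    (hf : Valid k (fun j => n (j + 1)) f) (hX : X ⊆ Finset.range (n 0))
    (hne : X = ∅ → f 0 = ∅) (hl : n 0 - 1 ∈ X → 0 < k → 0 ∈ f 0) :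
    Valid (k + 1) n (consConf (X, f)) where
  subset_range j := by
    cases j with
    | zero => exact hX
    | succ j => exact hf.subset_range j
  eq_empty j hj := by
    cases j with
    | zero => omega
    | succ j => exact hf.eq_empty j (by omega)
  succ_eq_empty j hj := by
    cases j with
    | zero => exact hne hj
    | succ j => exact hf.succ_eq_empty j hj
  closed j _ hjk hm := by
    cases j with
    | zero => exact hl hm (by omega)
    | succ j => exact hf.closed j (Nat.zero_le _) (by omega) hm

theorem exists_finset_valid (k : ℕ) : ∀ n : ℕ → ℕ, (∀ j, 2 ≤ n j) →
    ∃ F G : Finset (ℕ → Finset ℕ),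
      F.card = (UV (List.ofFn fun i : Fin k => n i)).1 ∧
      G.card = (UV (List.ofFn fun i : Fin k => n i)).2 ∧
      (∀ f ∈ F, Valid k n f) ∧ ∀ f ∈ G, Valid k n f ∧ (0 < k → 0 ∈ f 0) := by
  classical
  induction k with
  | zero =>
    intro n _
    have hv : Valid 0 n fun _ => ∅ :=
      ⟨by simp, by simp, by simp, fun j _ h => by omega⟩
    exact ⟨{fun _ => ∅}, {fun _ => ∅}, by simp [UV], by simp [UV], by simpa using hv,
      by simpa using hv⟩
  | succ k ih =>
    intro n hn
    obtain ⟨F, G, hF, hG, hFv, hGv⟩ := ih (fun j => n (j + 1)) fun j => hn _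
    obtain ⟨m, hm⟩ : ∃ m, n 0 = m + 2 := ⟨n 0 - 2, by have := hn 0; omega⟩
    have hlist : (List.ofFn fun i : Fin (k + 1) => n i) =
        n 0 :: List.ofFn fun i : Fin k => n (i + 1) := by
      simp [List.ofFn_succ]
    have hm1 : m + 2 - 1 = m + 1 := rfl
    rw [hlist, UV_cons (hn 0), hm, Nat.add_sub_cancel, hm1, ← hF, ← hG]
    clear hlist hF hG ih
    set P := (Finset.range (m + 1)).powerset with hP
    set R := ((Finset.Ico 1 (m + 1)).powerset).image (insert 0) with hR
    have hPmem : ∀ X ∈ P, X ⊆ Finset.range (m + 1) := fun X hX => Finset.mem_powerset.1 hX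
    have hRmem : ∀ X ∈ R, X ⊆ Finset.range (m + 1) ∧ 0 ∈ X := by
      intro X hX
      obtain ⟨Y, hY, rfl⟩ := Finset.mem_image.1 hX
      refine ⟨?_, Finset.mem_insert_self _ _⟩
      intro x hx
      rcases Finset.mem_insert.1 hx with rfl | hx
      · simp
      · have := Finset.mem_Ico.1 (Finset.mem_powerset.1 hY hx)
        exact Finset.mem_range.2 this.2
    have hins : ∀ (a : ℕ) (A : Finset (Finset ℕ)), (∀ X ∈ A, a ∉ X) →
        (A.image (insert a)).card = A.card := by
      intro a A hA
      refine Finset.card_image_of_injOn fun X hX Y hY h => ?_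
      rw [← Finset.erase_insert (hA X hX), ← Finset.erase_insert (hA Y hY)]
      exact congrArg (fun Z => Z.erase a) h
    have hnot : ∀ X : Finset ℕ, X ⊆ Finset.range (m + 1) → m + 1 ∉ X := by
      intro X hX h
      have := Finset.mem_range.1 (hX h)
      omega
    have hPcard : P.card = 2 ^ (m + 1) := by simp [hP]
    have hRcard : R.card = 2 ^ m := by
      rw [hR, hins, Finset.card_powerset, Nat.card_Ico, Nat.add_sub_cancel]
      intro X hX h
      have := Finset.mem_Ico.1 (Finset.mem_powerset.1 hX h)
      omega
    have hvF : ∀ X f, X ⊆ Finset.range (m + 1) → X.Nonempty → f ∈ F →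
        Valid (k + 1) n (consConf (X, f)) := by
      intro X f hX hne hf
      refine (hFv f hf).consConf ?_ (fun h => absurd h hne.ne_empty) ?_
      · rw [hm]
        exact hX.trans (Finset.range_subset_range.2 (by omega))
      · rw [hm]
        exact fun h => absurd h (hnot X hX)
    have hvG : ∀ X f, X ⊆ Finset.range (m + 1) → f ∈ G →
        Valid (k + 1) n (consConf (insert (m + 1) X, f)) := by
      intro X f hX hf
      refine (hGv f hf).1.consConf ?_ (fun h => absurd h (Finset.insert_ne_empty _ _))
        fun _ => (hGv f hf).2
      rw [hm]
      refine Finset.insert_subset (by simp) ?_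
      exact hX.trans (Finset.range_subset_range.2 (by omega))
    have hempty : Valid (k + 1) n fun _ => ∅ :=
      ⟨by simp, by simp, by simp, fun j _ _ h => by simp at h⟩
    have hdisj : ∀ A B : Finset (Finset ℕ), (∀ X ∈ A, X ⊆ Finset.range (m + 1)) →
        Disjoint (A ×ˢ F) (B.image (insert (m + 1)) ×ˢ G) := by
      intro A B hA
      rw [Finset.disjoint_left]
      rintro ⟨X, f⟩ h1 h2
      simp only [Finset.mem_product, Finset.mem_image] at h1 h2
      obtain ⟨⟨Y, -, rfl⟩, -⟩ := h2
      exact hnot _ (hA _ h1.1) (Finset.mem_insert_self _ _)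
    refine ⟨insert (fun _ => ∅)
      (((P.erase ∅) ×ˢ F ∪ (P.image (insert (m + 1))) ×ˢ G).image consConf),
      (R ×ˢ F ∪ (R.image (insert (m + 1))) ×ˢ G).image consConf, ?_, ?_, ?_, ?_⟩
    · rw [Finset.card_insert_of_notMem, Finset.card_image_of_injective _ consConf_injective,
        Finset.card_union_of_disjoint
          (hdisj _ _ fun X hX => hPmem X (Finset.mem_of_mem_erase hX)),
        Finset.card_product, Finset.card_product, hins _ _ fun X hX => hnot X (hPmem X hX),
        Finset.card_erase_of_mem (by simp [hP]), hPcard]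
      · omega
      · intro h
        obtain ⟨⟨X, f⟩, hXf, h⟩ := Finset.mem_image.1 h
        have h0 : X = ∅ := congrFun h 0
        subst h0
        simp [Finset.insert_ne_empty] at hXf
    · rw [Finset.card_image_of_injective _ consConf_injective,
        Finset.card_union_of_disjoint (hdisj _ _ fun X hX => (hRmem X hX).1),
        Finset.card_product, Finset.card_product,
        hins _ _ fun X hX => hnot X (hRmem X hX).1, hRcard, mul_add]
    · intro f hf
      rcases Finset.mem_insert.1 hf with rfl | hf
      · exact hempty
      obtain ⟨⟨X, f⟩, hXf, rfl⟩ := Finset.mem_image.1 hf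
      rcases Finset.mem_union.1 hXf with h | h
      · obtain ⟨hX, hf⟩ := Finset.mem_product.1 h
        obtain ⟨hne, hX⟩ := Finset.mem_erase.1 hX
        exact hvF X f (hPmem X hX) (Finset.nonempty_iff_ne_empty.2 hne) hf
      · obtain ⟨hX, hf⟩ := Finset.mem_product.1 h
        obtain ⟨Y, hY, rfl⟩ := Finset.mem_image.1 hX
        exact hvG Y f (hPmem Y hY) hf
    · intro f hf
      obtain ⟨⟨X, f⟩, hXf, rfl⟩ := Finset.mem_image.1 hf
      rcases Finset.mem_union.1 hXf with h | h
      · obtain ⟨hX, hf⟩ := Finset.mem_product.1 h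
        obtain ⟨hX, h0⟩ := hRmem X hX
        exact ⟨hvF X f hX ⟨0, h0⟩ hf, fun _ => h0⟩
      · obtain ⟨hX, hf⟩ := Finset.mem_product.1 h
        obtain ⟨Y, hY, rfl⟩ := Finset.mem_image.1 hX
        obtain ⟨hY, h0⟩ := hRmem Y hY
        exact ⟨hvG Y f hY hf, fun _ => Finset.mem_insert_of_mem h0⟩

theorem exists_finset_valid_singleton (k : ℕ) (n : ℕ → ℕ) (hn : ∀ j, 2 ≤ n j) :
    ∃ F : Finset (ℕ → Finset ℕ),
      F.card = Bval (n 0) (List.ofFn fun i : Fin k => n (i + 1)) ∧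
      ∀ f ∈ F, Valid (k + 1) n f ∧ ∃ q, f 0 = {q} := by
  classical
  obtain ⟨F, G, hF, hG, hFv, hGv⟩ := exists_finset_valid k (fun j => n (j + 1)) fun j => hn _
  have hn0 := hn 0
  refine ⟨(((Finset.range (n 0 - 1)).image singleton) ×ˢ F ∪ {{n 0 - 1}} ×ˢ G).image consConf,
    ?_, ?_⟩
  · rw [Finset.card_image_of_injective _ consConf_injective, Finset.card_union_of_disjoint,
      Finset.card_product, Finset.card_product,
      Finset.card_image_of_injective _ Finset.singleton_injective, Finset.card_range,
      Finset.card_singleton, one_mul, hF, hG, Bval]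
    rw [Finset.disjoint_left]
    rintro ⟨X, f⟩ h1 h2
    simp only [Finset.mem_product, Finset.mem_image, Finset.mem_singleton, Finset.mem_range]
      at h1 h2
    obtain ⟨⟨q, hq, rfl⟩, -⟩ := h1
    have := Finset.singleton_injective h2.1
    omega
  · intro f hf
    obtain ⟨⟨X, f⟩, hXf, rfl⟩ := Finset.mem_image.1 hf
    rcases Finset.mem_union.1 hXf with h | h
    · obtain ⟨hX, hf⟩ := Finset.mem_product.1 h
      obtain ⟨q, hq, rfl⟩ := Finset.mem_image.1 hX
      rw [Finset.mem_range] at hq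
      refine ⟨(hFv f hf).consConf ?_ (fun h => absurd h (Finset.singleton_ne_empty _)) ?_, q, rfl⟩
      · simp only [Finset.singleton_subset_iff, Finset.mem_range]
        omega
      · intro h
        have := Finset.mem_singleton.1 h
        omega
    · obtain ⟨hX, hf⟩ := Finset.mem_product.1 h
      obtain rfl := Finset.mem_singleton.1 hX
      refine ⟨(hGv f hf).1.consConf ?_ (fun h => absurd h (Finset.singleton_ne_empty _))
        fun _ => (hGv f hf).2, _, rfl⟩
      simp only [Finset.singleton_subset_iff, Finset.mem_range]
      omega

theorem card_le_of_accepts {k : ℕ} {n : ℕ → ℕ} (hn : ∀ j, 2 ≤ n j) (hk : 0 < k)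
    {F : Finset (ℕ → Finset ℕ)} (hF : ∀ f ∈ F, Valid k n f ∧ ∃ q, f 0 = {q})
    {Q : Type} [Fintype Q] (D : DFA (Fin (k + 1)) Q) (hD : D.accepts = prefixProd k n k) :
    F.card ≤ Fintype.card Q := by
  have hreach : ∀ f : F, ∃ w, run k n initConf w = f := fun f =>
    let ⟨hv, _, hq⟩ := hF f f.2
    hv.reachable hn hk hq
  choose w hw using hreach
  rw [← Fintype.card_coe]
  refine Fintype.card_le_of_injective (fun f => D.eval (w f)) fun f g hfg => ?_
  by_contra hne
  obtain ⟨z, hz⟩ := (hF f f.2).1.distinguishable hn (hF g g.2).1 (fun h => hne (Subtype.ext h))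
  refine hz ?_
  have hacc : ∀ f : F, n (k - 1) - 1 ∈ run k n f z (k - 1) ↔
      D.evalFrom (D.eval (w f)) z ∈ D.accept := by
    intro f
    have h1 : run k n f z = run k n initConf (w f ++ z) := by
      rw [← hw f]
      simp [run]
    rw [h1, ← mem_prefixProd_iff hn hk, ← hD, DFA.mem_accepts, DFA.eval,
      DFA.evalFrom_of_append]
  rw [hacc, hacc]
  exact iff_of_eq (congrArg (fun q => D.evalFrom q z ∈ D.accept) hfg)

/-- The `j`-th witness automaton. -/
def witness (k : ℕ) (n : ℕ → ℕ) (hn : ∀ j, 2 ≤ n j) (j : ℕ) : DFA (Fin (k + 1)) (Fin (n j)) where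
  step q a := ⟨trans k n j a q, trans_lt hn j a q.2⟩
  start := ⟨0, by have := hn j; omega⟩
  accept := {q | (q : ℕ) = n j - 1}

theorem accepts_witness (k : ℕ) (n : ℕ → ℕ) (hn : ∀ j, 2 ≤ n j) (j : ℕ) :
    (witness k n hn j).accepts = lang k n j := by
  have h : ∀ (w : List (Fin (k + 1))) q,
      (((witness k n hn j).evalFrom q w : Fin (n j)) : ℕ) = evalFrom k n j q w := by
    intro w
    induction w with
    | nil => intro q; rfl
    | cons a w ih => intro q; exact ih _
  ext w
  rw [DFA.mem_accepts, mem_lang]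
  exact iff_of_eq (congrArg (· = n j - 1) (h w _))

end MultiConcat

/-- For every `k ≥ 2` and `nᵢ ≥ 2` there are languages over a `(k+1)`-letter
alphabet, each accepted by a DFA with `nᵢ` states, whose concatenation needs at least
`B(n₁,…,n_k)` states. -/
theorem stmt9 (k : ℕ) (hk : 2 ≤ k) (n : Fin k → ℕ) (hn : ∀ i, 2 ≤ n i) :
    ∃ L : Fin k → Language (Fin (k + 1)),
      (∀ i, ∃ (Q : Type) (_ : Fintype Q) (D : DFA (Fin (k + 1)) Q),
        D.accepts = L i ∧ Fintype.card Q = n i) ∧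
      (∀ (Q : Type) (inst : Fintype Q) (D : DFA (Fin (k + 1)) Q),
        D.accepts = (List.ofFn L).prod →
        Bval (n ⟨0, Nat.lt_of_lt_of_le Nat.zero_lt_two hk⟩) ((List.ofFn n).drop 1)
          ≤ @Fintype.card Q inst) := by
  obtain ⟨N, hN, hNn⟩ : ∃ N : ℕ → ℕ, (∀ j, 2 ≤ N j) ∧ ∀ i : Fin k, N i = n i := by
    refine ⟨fun j => if h : j < k then n ⟨j, h⟩ else 2, fun j => ?_, fun i => by simp⟩
    dsimp only
    split_ifs
    · exact hn _
    · exact le_rfl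
  obtain rfl : n = fun i : Fin k => N i := funext fun i => (hNn i).symm
  refine ⟨fun i => MultiConcat.lang k N i, fun i =>
    ⟨Fin (N i), inferInstance, MultiConcat.witness k N hN i,
      MultiConcat.accepts_witness k N hN i, Fintype.card_fin _⟩, ?_⟩
  intro Q _ D hD
  obtain ⟨m, rfl⟩ : ∃ m, k = m + 1 := ⟨k - 1, by omega⟩
  obtain ⟨F, hF, hFv⟩ := MultiConcat.exists_finset_valid_singleton m N hN
  have hprod : (List.ofFn fun i : Fin (m + 1) => MultiConcat.lang (m + 1) N i).prod =
      MultiConcat.prefixProd (m + 1) N (m + 1) := by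
    rw [MultiConcat.prefixProd, ← List.map_coe_finRange_eq_range, List.map_map, List.ofFn_eq_map]
    rfl
  have hlist : (List.ofFn fun i : Fin (m + 1) => N i).drop 1 =
      List.ofFn fun i : Fin m => N (i + 1) := by
    simp [List.ofFn_succ]
  have := MultiConcat.card_le_of_accepts hN (Nat.succ_pos m) hFv D (hD.trans hprod)
  rw [hlist]
  exact hF ▸ this
end

section
/- Let n₁, n₂ ≥ 2. Over the alphabet {a, b}, let A be the DFA with state set Fin n₁, start state 0 and unique accepting state n₁−1, where a acts as q ↦ q+1 (mod n₁) and b fixes 0 and n₁−1 and maps every other state to 0; and let B be the DFA with state set Fin n₂, start state 0 and unique accepting state n₂−1, where a acts as q ↦ q+1 (mod n₂) and b fixes 0 and maps every state q ≠ 0 to q+1 (mod n₂). Then the minimal DFA for the concatenation L(A)L(B) has exactly (n₁−1)·2^{n₂} + 2^{n₂−1} states: L(A)L(B) is accepted by some DFA with (n₁−1)·2^{n₂} + 2^{n₂−1} states and by no DFA with fewer states. -/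
/-- The binary witness DFA `A` (alphabet `Bool`, `a = false`, `b = true`): state set `Fin n`,
start `0`, unique accepting state `n−1`; `a` acts as `q ↦ q+1 (mod n)`, and `b` fixes `0` and
`n−1` and maps every other state to `0`. -/
def dfaA (n : ℕ) (hn : 2 ≤ n) : DFA Bool (Fin n) :=
  haveI : NeZero n := ⟨by omega⟩
  { step := fun q c =>
      match c with
      | false => q + 1
      | true => if q.val = 0 ∨ q.val = n - 1 then q else 0
    start := 0
    accept := {⟨n - 1, by omega⟩} }

/-- The binary witness DFA `B` (alphabet `Bool`, `a = false`, `b = true`): state set `Fin n`,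
start `0`, unique accepting state `n−1`; `a` acts as `q ↦ q+1 (mod n)`, and `b` fixes `0` and
maps every state `q ≠ 0` to `q+1 (mod n)`. -/
def dfaB (n : ℕ) (hn : 2 ≤ n) : DFA Bool (Fin n) :=
  haveI : NeZero n := ⟨by omega⟩
  { step := fun q c =>
      match c with
      | false => q + 1
      | true => if q.val = 0 then q else q + 1
    start := 0
    accept := {⟨n - 1, by omega⟩} }

namespace DFA

variable {α σ₁ σ₂ : Type*}

/-- The subset-construction automaton for the concatenation of the languages of `M` and `N`: it
runs `M` and keeps track of the states of `N` reachable after reading a prefix accepted by `M`. -/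
def concat (M : DFA α σ₁) (N : DFA α σ₂) : DFA α (σ₁ × Set σ₂) where
  step x c := (M.step x.1 c,
    {t | (∃ s ∈ x.2, N.step s c = t) ∨ (M.step x.1 c ∈ M.accept ∧ t = N.start)})
  start := (M.start, {t | M.start ∈ M.accept ∧ t = N.start})
  accept := {x | ∃ s ∈ x.2, s ∈ N.accept}

theorem concat_eval (M : DFA α σ₁) (N : DFA α σ₂) (w : List α) :
    (M.concat N).eval w =
      (M.eval w, {t | ∃ u v, u ++ v = w ∧ M.eval u ∈ M.accept ∧ N.eval v = t}) := by
  induction w using List.reverseRecOn with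
  | nil =>
    ext t
    · rfl
    · simp only [concat, eval_nil, List.append_eq_nil_iff, Set.mem_ofPred_eq]
      constructor
      · rintro ⟨h, rfl⟩
        exact ⟨[], [], ⟨rfl, rfl⟩, h, rfl⟩
      · rintro ⟨u, v, ⟨rfl, rfl⟩, h, rfl⟩
        exact ⟨h, rfl⟩
  | append_singleton w c ih =>
    rw [eval_append_singleton, ih]
    ext t
    · simp [concat]
    · simp only [concat, Set.mem_ofPred_eq]
      constructor
      · rintro (⟨_, ⟨u, v, rfl, hu, rfl⟩, rfl⟩ | ⟨h, rfl⟩)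
        · exact ⟨u, v ++ [c], by simp, hu, by simp⟩
        · exact ⟨w ++ [c], [], by simp, by simpa using h, rfl⟩
      · rintro ⟨u, v, huv, hu, rfl⟩
        rcases List.eq_nil_or_concat' v with rfl | ⟨v, d, rfl⟩
        · right
          rw [List.append_nil] at huv
          subst huv
          exact ⟨by simpa using hu, rfl⟩
        · left
          rw [← List.append_assoc] at huv
          obtain ⟨rfl, hd⟩ := List.append_inj' huv rfl
          cases hd
          exact ⟨_, ⟨u, v, rfl, hu, rfl⟩, by simp⟩

theorem concat_accepts (M : DFA α σ₁) (N : DFA α σ₂) :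
    (M.concat N).accepts = M.accepts * N.accepts := by
  ext w
  rw [mem_accepts, concat_eval, Language.mem_mul]
  constructor
  · rintro ⟨_, ⟨u, v, huv, hu, rfl⟩, hv⟩
    exact ⟨u, hu, v, hv, huv⟩
  · rintro ⟨u, hu, v, hv, huv⟩
    exact ⟨_, ⟨u, v, huv, hu, rfl⟩, hv⟩

/-- The states of `M.concat N` whose second component contains the start state of `N` whenever the
first component is accepting. -/
abbrev ConcatState (M : DFA α σ₁) (N : DFA α σ₂) : Type _ :=
  {x : σ₁ × Set σ₂ // x.1 ∈ M.accept → N.start ∈ x.2}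

/-- The restriction of `M.concat N` to `ConcatState M N`. -/
def concatRestrict (M : DFA α σ₁) (N : DFA α σ₂) : DFA α (ConcatState M N) where
  step x c := ⟨(M.concat N).step x.1 c, fun h => Or.inr ⟨h, rfl⟩⟩
  start := ⟨(M.concat N).start, fun h => ⟨h, rfl⟩⟩
  accept := {x | x.1 ∈ (M.concat N).accept}

theorem concatRestrict_eval (M : DFA α σ₁) (N : DFA α σ₂) (w : List α) :
    ((M.concatRestrict N).eval w).1 = (M.concat N).eval w := by
  induction w using List.reverseRecOn with
  | nil => rfl
  | append_singleton w c ih =>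
    rw [eval_append_singleton, eval_append_singleton, ← ih]
    rfl

theorem concatRestrict_accepts (M : DFA α σ₁) (N : DFA α σ₂) :
    (M.concatRestrict N).accepts = M.accepts * N.accepts := by
  rw [← concat_accepts]
  ext w
  rw [mem_accepts, mem_accepts, ← concatRestrict_eval]
  rfl

/-- If every element of a finite type `X` labels a state of `M` reached by some word, and states
with distinct labels have distinct languages, then every DFA for the language of `M` has at least
as many states as `X` has elements. -/
theorem card_le_of_accepts_eq {σ X τ : Type*} [Fintype X] [Fintype τ]
    (M : DFA α σ) (f : X → σ) (hreach : ∀ x, ∃ w, M.eval w = f x)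
    (hdist : ∀ x y, M.acceptsFrom (f x) = M.acceptsFrom (f y) → x = y)
    (D : DFA α τ) (hD : D.accepts = M.accepts) : Fintype.card X ≤ Fintype.card τ := by
  choose w hw using hreach
  refine Fintype.card_le_of_injective (fun x => D.eval (w x)) fun x y hxy => hdist x y ?_
  have key : ∀ x v, v ∈ M.acceptsFrom (f x) ↔ D.evalFrom (D.eval (w x)) v ∈ D.accept := by
    intro x v
    rw [mem_acceptsFrom, ← hw, eval, ← evalFrom_of_append, eval, ← evalFrom_of_append]
    change w x ++ v ∈ M.accepts ↔ w x ++ v ∈ D.accepts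
    rw [hD]
  ext v
  rw [key, key]
  exact iff_of_eq (by rw [show D.eval (w x) = D.eval (w y) from hxy])

theorem acceptsFrom_step_eq {σ : Type*} {M : DFA α σ} {x y : σ}
    (h : M.acceptsFrom x = M.acceptsFrom y) (c : α) :
    M.acceptsFrom (M.step x c) = M.acceptsFrom (M.step y c) := by
  ext v
  have := Set.ext_iff.mp h (c :: v)
  exact this

theorem exists_eval_step {σ : Type*} {M : DFA α σ} {x : σ} (h : ∃ w, M.eval w = x) (c : α) :
    ∃ w, M.eval w = M.step x c := by
  obtain ⟨w, rfl⟩ := h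
  exact ⟨w ++ [c], by simp⟩

end DFA

section Witness

variable {n n₁ n₂ : ℕ} {hn : 2 ≤ n} {h₁ : 2 ≤ n₁} {h₂ : 2 ≤ n₂}

theorem Fin.val_add_one_eq_ite [NeZero n] (hn : 2 ≤ n) (q : Fin n) :
    (q + 1).val = if q.val + 1 = n then 0 else q.val + 1 := by
  have := q.isLt
  rw [Fin.val_add, Fin.val_one', Nat.mod_eq_of_lt (a := 1) (by omega)]
  split_ifs with h
  · rw [h, Nat.mod_self]
  · exact Nat.mod_eq_of_lt (by omega)

theorem dfaA_step_false_val (q : Fin n) :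
    ((dfaA n hn).step q false).val = if q.val + 1 = n then 0 else q.val + 1 :=
  haveI : NeZero n := ⟨by omega⟩
  Fin.val_add_one_eq_ite hn q

theorem dfaA_step_true_val (q : Fin n) :
    ((dfaA n hn).step q true).val = if q.val + 1 = n then q.val else 0 := by
  have := q.isLt
  simp only [dfaA]
  split_ifs <;> first | omega | rfl

theorem dfaB_step_false_val (q : Fin n) :
    ((dfaB n hn).step q false).val = if q.val + 1 = n then 0 else q.val + 1 :=
  haveI : NeZero n := ⟨by omega⟩
  Fin.val_add_one_eq_ite hn q

theorem dfaB_step_true_val (q : Fin n) :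
    ((dfaB n hn).step q true).val =
      if q.val = 0 then 0 else if q.val + 1 = n then 0 else q.val + 1 := by
  have : NeZero n := ⟨by omega⟩
  by_cases h : q.val = 0
  · rw [if_pos h, ← h]
    exact congrArg Fin.val (if_pos h)
  · rw [if_neg h, ← Fin.val_add_one_eq_ite hn q]
    exact congrArg Fin.val (if_neg h)

theorem mem_dfaA_accept (q : Fin n) : q ∈ (dfaA n hn).accept ↔ q.val + 1 = n := by
  have := q.isLt
  simp only [dfaA, Set.mem_singleton_iff, Fin.ext_iff]
  omega

theorem mem_dfaB_accept (q : Fin n) : q ∈ (dfaB n hn).accept ↔ q.val + 1 = n := by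
  have := q.isLt
  simp only [dfaB, Set.mem_singleton_iff, Fin.ext_iff]
  omega

theorem dfaA_start_val : (dfaA n hn).start.val = 0 := rfl

theorem dfaB_start_val : (dfaB n hn).start.val = 0 := rfl

theorem dfaB_step_false_bijective : Function.Bijective fun q => (dfaB n hn).step q false := by
  refine Finite.injective_iff_bijective.mp fun x y h => ?_
  have hx := x.isLt
  have hy := y.isLt
  have := congrArg Fin.val h
  simp only [dfaB_step_false_val] at this
  ext
  split_ifs at this <;> omega

/-- The subset automaton for the concatenation of the two witnesses. -/
abbrev witnessConcat (h₁ : 2 ≤ n₁) (h₂ : 2 ≤ n₂) : DFA Bool (Fin n₁ × Set (Fin n₂)) :=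
  (dfaA n₁ h₁).concat (dfaB n₂ h₂)

/-! ### Reachability -/

theorem ncard_preimage_step_false (S : Set (Fin n)) :
    ((fun q => (dfaB n hn).step q false) ⁻¹' S).ncard = S.ncard :=
  Set.ncard_preimage_of_injective_subset_range dfaB_step_false_bijective.1
    (by simp [dfaB_step_false_bijective.2.range_eq])

theorem witnessConcat_step_false_preimage (q : Fin n₁) (S : Set (Fin n₂))
    (hS : (dfaA n₁ h₁).step q false ∈ (dfaA n₁ h₁).accept → (dfaB n₂ h₂).start ∈ S) :
    (witnessConcat h₁ h₂).step (q, (fun s => (dfaB n₂ h₂).step s false) ⁻¹' S) false =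
      ((dfaA n₁ h₁).step q false, S) := by
  ext t
  · rfl
  · constructor
    · rintro (⟨s, hs, rfl⟩ | ⟨h, rfl⟩)
      · exact hs
      · exact hS h
    · intro ht
      obtain ⟨s, rfl⟩ := (dfaB_step_false_bijective (hn := h₂)).2 t
      exact Or.inl ⟨s, ht, rfl⟩

theorem witnessConcat_step_false_preimage_diff (q : Fin n₁) (S : Set (Fin n₂))
    (hq : (dfaA n₁ h₁).step q false ∈ (dfaA n₁ h₁).accept) (hS : (dfaB n₂ h₂).start ∈ S) :
    (witnessConcat h₁ h₂).step
        (q, (fun s => (dfaB n₂ h₂).step s false) ⁻¹' (S \ {(dfaB n₂ h₂).start})) false =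
      ((dfaA n₁ h₁).step q false, S) := by
  ext t
  · rfl
  · constructor
    · rintro (⟨s, hs, rfl⟩ | ⟨h, rfl⟩)
      · exact hs.1
      · exact hS
    · intro ht
      by_cases h0 : t = (dfaB n₂ h₂).start
      · exact Or.inr ⟨hq, h0⟩
      · obtain ⟨s, rfl⟩ := (dfaB_step_false_bijective (hn := h₂)).2 t
        exact Or.inl ⟨s, ⟨ht, h0⟩, rfl⟩

theorem exists_eval_of_not_accept {k : ℕ}
    (H : ∀ (q : Fin n₁) (S : Set (Fin n₂)), q.val = 0 → S.ncard ≤ k →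
      ∃ w, (witnessConcat h₁ h₂).eval w = (q, S)) (j : ℕ) :
    ∀ (q : Fin n₁) (S : Set (Fin n₂)), q.val = j → j + 1 < n₁ → S.ncard ≤ k →
      ∃ w, (witnessConcat h₁ h₂).eval w = (q, S) := by
  induction j with
  | zero => exact fun q S hq _ hS => H q S hq hS
  | succ j ih =>
    intro q S hq hj hS
    have hstep : (dfaA n₁ h₁).step ⟨j, by omega⟩ false = q := by
      ext
      rw [dfaA_step_false_val, hq, if_neg]
      simp only
      omega
    have := DFA.exists_eval_step (ih ⟨j, by omega⟩ _ rfl (by omega)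
      ((ncard_preimage_step_false (hn := h₂) S).trans_le hS)) false
    rwa [witnessConcat_step_false_preimage, hstep] at this
    rw [hstep, mem_dfaA_accept]
    omega

theorem exists_eval_of_accept {k : ℕ}
    (H : ∀ (q : Fin n₁) (S : Set (Fin n₂)), q.val = 0 → S.ncard ≤ k →
      ∃ w, (witnessConcat h₁ h₂).eval w = (q, S))
    (q : Fin n₁) (S : Set (Fin n₂)) (hq : q.val + 1 = n₁) (h0 : (dfaB n₂ h₂).start ∈ S)
    (hS : S.ncard ≤ k + 1) : ∃ w, (witnessConcat h₁ h₂).eval w = (q, S) := by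
  have hstep : (dfaA n₁ h₁).step ⟨n₁ - 2, by omega⟩ false = q := by
    ext
    rw [dfaA_step_false_val, if_neg]
    all_goals simp only
    all_goals omega
  have hcard : (S \ {(dfaB n₂ h₂).start}).ncard ≤ k := by
    rw [Set.ncard_sdiff_singleton_of_mem h0]
    omega
  have := DFA.exists_eval_step (exists_eval_of_not_accept H (n₁ - 2) ⟨n₁ - 2, by omega⟩ _ rfl
    (by omega) ((ncard_preimage_step_false (hn := h₂) _).trans_le hcard)) false
  rwa [witnessConcat_step_false_preimage_diff _ _ _ h0, hstep] at this
  rwa [hstep, mem_dfaA_accept]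

theorem exists_eval_of_one_mem {k : ℕ}
    (H : ∀ (q : Fin n₁) (S : Set (Fin n₂)), q.val = 0 → S.ncard ≤ k →
      ∃ w, (witnessConcat h₁ h₂).eval w = (q, S))
    (q : Fin n₁) (S : Set (Fin n₂)) (hq : q.val = 0) (h1 : ⟨1, h₂⟩ ∈ S)
    (hS : S.ncard ≤ k + 1) : ∃ w, (witnessConcat h₁ h₂).eval w = (q, S) := by
  have hstep : (dfaA n₁ h₁).step ⟨n₁ - 1, by omega⟩ false = q := by
    ext
    rw [dfaA_step_false_val, hq, if_pos]
    simp only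
    omega
  have hstart : (dfaB n₂ h₂).step (dfaB n₂ h₂).start false = ⟨1, h₂⟩ := by
    ext
    rw [dfaB_step_false_val, dfaB_start_val, if_neg (by omega)]
  have := DFA.exists_eval_step (exists_eval_of_accept H ⟨n₁ - 1, by omega⟩
    ((fun s => (dfaB n₂ h₂).step s false) ⁻¹' S) (by simp only; omega)
    (by rwa [Set.mem_preimage, hstart])
    ((ncard_preimage_step_false (hn := h₂) S).trans_le hS)) false
  rwa [witnessConcat_step_false_preimage, hstep] at this
  rw [hstep, mem_dfaA_accept]
  omega

theorem exists_eval_of_mem {k : ℕ}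
    (H : ∀ (q : Fin n₁) (S : Set (Fin n₂)), q.val = 0 → S.ncard ≤ k →
      ∃ w, (witnessConcat h₁ h₂).eval w = (q, S)) (m : ℕ) :
    ∀ (q : Fin n₁) (S : Set (Fin n₂)) (s : Fin n₂), q.val = 0 → s ∈ S → s.val = m + 1 →
      S.ncard ≤ k + 1 → ∃ w, (witnessConcat h₁ h₂).eval w = (q, S) := by
  induction m with
  | zero =>
    intro q S s hq hs hsm hS
    refine exists_eval_of_one_mem H q S hq ?_ hS
    rwa [show (⟨1, h₂⟩ : Fin n₂) = s from Fin.ext hsm.symm]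
  | succ m ih =>
    intro q S s hq hs hsm hS
    by_cases h1 : ⟨1, h₂⟩ ∈ S
    · exact exists_eval_of_one_mem H q S hq h1 hS
    set P : Set (Fin n₂) := {t | (dfaB n₂ h₂).step t true ∈ S ∧ t.val + 1 ≠ n₂}
    have hslt := s.isLt
    have hstep : (dfaA n₁ h₁).step q true = q := by
      ext
      rw [dfaA_step_true_val, hq, ite_self]
    have hpred : ∀ t ∈ S, ∃ u ∈ P, (dfaB n₂ h₂).step u true = t := by
      intro t ht
      have htlt := t.isLt
      have ht1 : t.val ≠ 1 := fun h => h1 (by rwa [show (⟨1, h₂⟩ : Fin n₂) = t from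
        Fin.ext h.symm])
      have hut : (dfaB n₂ h₂).step ⟨t.val - 1, by omega⟩ true = t := by
        ext
        rw [dfaB_step_true_val]
        simp only
        split_ifs <;> omega
      exact ⟨_, ⟨hut.symm ▸ ht, by simp only; omega⟩, hut⟩
    have hPcard : P.ncard ≤ S.ncard := by
      refine Set.ncard_le_ncard_of_injOn (fun t => (dfaB n₂ h₂).step t true)
        (fun t ht => ht.1) ?_
      intro x hx y hy hxy
      have hx' := hx.2
      have hy' := hy.2
      have := congrArg Fin.val hxy
      simp only [dfaB_step_true_val] at this
      ext
      split_ifs at this <;> omega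
    have hmem : ⟨m + 1, by omega⟩ ∈ P := by
      have : (dfaB n₂ h₂).step ⟨m + 1, by omega⟩ true = s := by
        ext
        rw [dfaB_step_true_val, if_neg (by simp), if_neg (by simp only; omega), hsm]
      exact ⟨this.symm ▸ hs, by simp only; omega⟩
    have := DFA.exists_eval_step (ih q P _ hq hmem rfl (hPcard.trans hS)) true
    suffices h : (witnessConcat h₁ h₂).step (q, P) true = (q, S) by rwa [h] at this
    ext t
    · simp [DFA.concat, hstep]
    · constructor
      rotate_left
      · exact fun ht => Or.inl (hpred t ht)
      · rintro (⟨u, hu, rfl⟩ | ⟨h, rfl⟩)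
        · exact hu.1
        · rw [hstep, mem_dfaA_accept] at h
          omega

theorem exists_eval_of_val_eq_zero (k : ℕ) :
    ∀ (q : Fin n₁) (S : Set (Fin n₂)), q.val = 0 → S.ncard ≤ k →
      ∃ w, (witnessConcat h₁ h₂).eval w = (q, S) := by
  induction k with
  | zero =>
    intro q S hq hS
    have hS' : S = ∅ := (Set.ncard_eq_zero).mp (by omega)
    subst hS'
    refine ⟨[], ?_⟩
    ext t
    · simp [DFA.concat, hq, dfaA_start_val]
    · have := mem_dfaA_accept (hn := h₁) (dfaA n₁ h₁).start
      rw [dfaA_start_val] at this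
      simp only [DFA.concat, DFA.eval_nil, Set.mem_ofPred_eq, this, Set.mem_empty_iff_false,
        iff_false]
      omega
  | succ k ih =>
    intro q S hq hS
    by_cases hne : ∃ s ∈ S, s.val ≠ 0
    · obtain ⟨s, hs, hs0⟩ := hne
      exact exists_eval_of_mem ih (s.val - 1) q S s hq hs (by omega) hS
    push Not at hne
    rcases S.eq_empty_or_nonempty with rfl | ⟨s, hs⟩
    · exact ih q ∅ hq (by simp)
    have hS0 : S = {s} := by
      refine Set.eq_singleton_iff_unique_mem.mpr ⟨hs, fun t ht => Fin.ext ?_⟩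
      rw [hne t ht, hne s hs]
    have hs0 := hne s hs
    subst hS0
    have hlast : (dfaB n₂ h₂).step ⟨n₂ - 1, by omega⟩ true = s := by
      ext
      rw [dfaB_step_true_val]
      simp only
      split_ifs <;> omega
    have hstep : (dfaA n₁ h₁).step q true = q := by
      ext
      rw [dfaA_step_true_val, hq, ite_self]
    have := DFA.exists_eval_step (exists_eval_of_mem ih (n₂ - 2) q {⟨n₂ - 1, by omega⟩}
      ⟨n₂ - 1, by omega⟩ hq rfl (by simp only; omega) (by simp)) true
    suffices h : (witnessConcat h₁ h₂).step (q, {⟨n₂ - 1, by omega⟩}) true = (q, {s}) by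
      rwa [h] at this
    ext t
    · simp [DFA.concat, hstep]
    · have : q ∉ (dfaA n₁ h₁).accept := by
        rw [mem_dfaA_accept]
        omega
      simp [DFA.concat, hstep, hlast, this, eq_comm]

theorem witnessConcat_exists_eval (q : Fin n₁) (S : Set (Fin n₂))
    (h : q ∈ (dfaA n₁ h₁).accept → (dfaB n₂ h₂).start ∈ S) :
    ∃ w, (witnessConcat h₁ h₂).eval w = (q, S) := by
  by_cases hq : q ∈ (dfaA n₁ h₁).accept
  · exact exists_eval_of_accept (exists_eval_of_val_eq_zero S.ncard) q S
      ((mem_dfaA_accept q).mp hq) (h hq) (by omega)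
  · rw [mem_dfaA_accept] at hq
    exact exists_eval_of_not_accept (exists_eval_of_val_eq_zero S.ncard) q.val q S rfl
      (by omega) le_rfl

/-! ### Distinguishability -/

theorem mem_iff_of_acceptsFrom_eq (d : ℕ) :
    ∀ {p q : Fin n₁} {S T : Set (Fin n₂)},
      (witnessConcat h₁ h₂).acceptsFrom (p, S) = (witnessConcat h₁ h₂).acceptsFrom (q, T) →
      ∀ i : Fin n₂, i.val + d + 1 = n₂ → (i ∈ S ↔ i ∈ T) := by
  induction d with
  | zero =>
    intro p q S T h i hi
    have key : ∀ (p : Fin n₁) (S : Set (Fin n₂)),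
        [] ∈ (witnessConcat h₁ h₂).acceptsFrom (p, S) ↔ i ∈ S := by
      intro p S
      constructor
      · rintro ⟨s, hs, hs'⟩
        rw [mem_dfaB_accept] at hs'
        rwa [show i = s from Fin.ext (by omega)]
      · exact fun hs => ⟨i, hs, (mem_dfaB_accept i).mpr hi⟩
    rw [← key p S, h, key]
  | succ d ih =>
    intro p q S T h i hi
    have hstep : ((dfaB n₂ h₂).step i false).val = i.val + 1 := by
      rw [dfaB_step_false_val, if_neg (by omega)]
    have key : ∀ (p : Fin n₁) (S : Set (Fin n₂)),
        (dfaB n₂ h₂).step i false ∈ ((witnessConcat h₁ h₂).step (p, S) false).2 ↔ i ∈ S := by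
      intro p S
      constructor
      · rintro (⟨s, hs, hs'⟩ | ⟨_, hs⟩)
        · rwa [← dfaB_step_false_bijective.1 hs']
        · have := congrArg Fin.val hs
          rw [hstep, dfaB_start_val] at this
          omega
      · exact fun hs => Or.inl ⟨i, hs, rfl⟩
    rw [← key p S, ← key q T]
    exact ih (DFA.acceptsFrom_step_eq h false) _ (by omega)

theorem snd_eq_of_acceptsFrom_eq {x y : Fin n₁ × Set (Fin n₂)}
    (h : (witnessConcat h₁ h₂).acceptsFrom x = (witnessConcat h₁ h₂).acceptsFrom y) :
    x.2 = y.2 := by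
  ext i
  have := i.isLt
  exact mem_iff_of_acceptsFrom_eq (n₂ - 1 - i.val) h i (by omega)

/-- Two equivalent states have equivalent successors sharing the second component. -/
theorem acceptsFrom_step_eq_of_snd {p q : Fin n₁} {S : Set (Fin n₂)} {c : Bool}
    (h : (witnessConcat h₁ h₂).acceptsFrom (p, S) = (witnessConcat h₁ h₂).acceptsFrom (q, S)) :
    ∃ T, ((witnessConcat h₁ h₂).step (p, S) c).2 = T ∧
      ((witnessConcat h₁ h₂).step (q, S) c).2 = T ∧
      (witnessConcat h₁ h₂).acceptsFrom ((dfaA n₁ h₁).step p c, T) =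
        (witnessConcat h₁ h₂).acceptsFrom ((dfaA n₁ h₁).step q c, T) := by
  have h' := DFA.acceptsFrom_step_eq h c
  have h2 := snd_eq_of_acceptsFrom_eq h'
  refine ⟨_, rfl, h2.symm, h'.trans (congrArg _ ?_)⟩
  exact Prod.ext rfl h2.symm

theorem subsingleton_step_snd {q : Fin n₁} {S : Set (Fin n₂)} {c : Bool}
    (hS : S.Subsingleton) (hq : (dfaA n₁ h₁).step q c ∉ (dfaA n₁ h₁).accept) :
    ((witnessConcat h₁ h₂).step (q, S) c).2.Subsingleton := by
  rintro _ (⟨s, hs, rfl⟩ | ⟨h, _⟩) _ (⟨t, ht, rfl⟩ | ⟨h, _⟩)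
  · rw [hS hs ht]
  all_goals exact absurd h hq

theorem acceptsFrom_succ_ne (d : ℕ) :
    ∀ (p q : Fin n₁) (S : Set (Fin n₂)), p.val = q.val + 1 → p.val + d + 1 = n₁ →
      S.Subsingleton → (d = 0 → (dfaB n₂ h₂).start ∈ S) →
      (witnessConcat h₁ h₂).acceptsFrom (p, S) ≠ (witnessConcat h₁ h₂).acceptsFrom (q, S) := by
  induction d with
  | zero =>
    intro p q S hpq hp hS h0 h
    obtain ⟨T, hT, hT', -⟩ := acceptsFrom_step_eq_of_snd (c := false) h
    have hq : (dfaA n₁ h₁).step q false ∈ (dfaA n₁ h₁).accept := by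
      rw [mem_dfaA_accept, dfaA_step_false_val, if_neg] <;> omega
    have hmem : (dfaB n₂ h₂).start ∈ T := hT' ▸ Or.inr ⟨hq, rfl⟩
    rw [← hT] at hmem
    rcases hmem with ⟨s, hs, hs'⟩ | ⟨hp', -⟩
    · have := hS hs (h0 rfl)
      subst this
      have := congrArg Fin.val hs'
      rw [dfaB_step_false_val, dfaB_start_val, if_neg (by omega)] at this
      omega
    · rw [mem_dfaA_accept, dfaA_step_false_val, if_pos (by omega)] at hp'
      omega
  | succ d ih =>
    intro p q S hpq hp hS _ h
    obtain ⟨T, hT, hT', hstep⟩ := acceptsFrom_step_eq_of_snd (c := false) h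
    have hpv : ((dfaA n₁ h₁).step p false).val = p.val + 1 := by
      rw [dfaA_step_false_val, if_neg (by omega)]
    have hqv : ((dfaA n₁ h₁).step q false).val = q.val + 1 := by
      rw [dfaA_step_false_val, if_neg (by omega)]
    refine ih _ _ T (by omega) (by omega) ?_ ?_ hstep
    · rw [← hT']
      refine subsingleton_step_snd hS ?_
      rw [mem_dfaA_accept]
      omega
    · intro hd
      rw [← hT]
      refine Or.inr ⟨?_, rfl⟩
      change (dfaA n₁ h₁).step p false ∈ _
      rw [mem_dfaA_accept]
      omega

theorem acceptsFrom_last_ne_of_bound (d : ℕ) :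
    ∀ (p q : Fin n₁) (S : Set (Fin n₂)), p.val = 0 → q.val + 1 = n₁ →
      (∀ s ∈ S, s.val ≠ 0 → n₂ ≤ s.val + d) →
      (witnessConcat h₁ h₂).acceptsFrom (p, S) ≠ (witnessConcat h₁ h₂).acceptsFrom (q, S) := by
  induction d with
  | zero =>
    intro p q S hp hq hS h
    have hsub : S.Subsingleton := by
      intro s hs t ht
      have hs' := hS s hs
      have ht' := hS t ht
      have := s.isLt
      have := t.isLt
      ext
      omega
    obtain ⟨T, hT, hT', hstep⟩ := acceptsFrom_step_eq_of_snd (c := false) h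
    have hpv : ((dfaA n₁ h₁).step p false).val = 1 := by
      rw [dfaA_step_false_val, if_neg (by omega), hp]
    have hqv : ((dfaA n₁ h₁).step q false).val = 0 := by
      rw [dfaA_step_false_val, if_pos hq]
    refine acceptsFrom_succ_ne (n₁ - 2) _ _ T (by omega) (by omega) ?_ ?_ hstep
    · rw [← hT']
      refine subsingleton_step_snd hsub ?_
      rw [mem_dfaA_accept]
      omega
    · intro hd
      rw [← hT]
      refine Or.inr ⟨?_, rfl⟩
      change (dfaA n₁ h₁).step p false ∈ _
      rw [mem_dfaA_accept]
      omega
  | succ d ih =>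
    intro p q S hp hq hS h
    obtain ⟨T, hT, hT', hstep⟩ := acceptsFrom_step_eq_of_snd (c := true) h
    refine ih _ _ T ?_ ?_ ?_ hstep
    · rw [dfaA_step_true_val, hp, ite_self]
    · rwa [dfaA_step_true_val, if_pos hq]
    · rw [← hT]
      rintro _ (⟨s, hs, rfl⟩ | ⟨_, rfl⟩) h0
      · have := hS s hs
        rw [dfaB_step_true_val] at h0 ⊢
        split_ifs at h0 ⊢ <;> omega
      · exact absurd dfaB_start_val h0

theorem acceptsFrom_ne_of_lt (d : ℕ) :
    ∀ (p q : Fin n₁) (S : Set (Fin n₂)), p.val < q.val → q.val + d + 1 = n₁ →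
      (witnessConcat h₁ h₂).acceptsFrom (p, S) ≠ (witnessConcat h₁ h₂).acceptsFrom (q, S) := by
  induction d with
  | zero =>
    intro p q S hpq hq h
    obtain ⟨T, -, -, hstep⟩ := acceptsFrom_step_eq_of_snd (c := true) h
    refine acceptsFrom_last_ne_of_bound n₂ _ _ T ?_ ?_ (fun s _ _ => by omega) hstep
    · rw [dfaA_step_true_val, if_neg (by omega)]
    · rwa [dfaA_step_true_val, if_pos hq]
  | succ d ih =>
    intro p q S hpq hq h
    obtain ⟨T, -, -, hstep⟩ := acceptsFrom_step_eq_of_snd (c := false) h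
    have hpv : ((dfaA n₁ h₁).step p false).val = p.val + 1 := by
      rw [dfaA_step_false_val, if_neg (by omega)]
    have hqv : ((dfaA n₁ h₁).step q false).val = q.val + 1 := by
      rw [dfaA_step_false_val, if_neg (by omega)]
    exact ih _ _ T (by omega) (by omega) hstep

theorem witnessConcat_acceptsFrom_injective :
    Function.Injective (witnessConcat h₁ h₂).acceptsFrom := by
  rintro ⟨p, S⟩ ⟨q, T⟩ h
  obtain rfl : S = T := snd_eq_of_acceptsFrom_eq h
  have hp := p.isLt
  have hq := q.isLt
  rcases lt_trichotomy p.val q.val with hpq | hpq | hpq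
  · exact absurd h (acceptsFrom_ne_of_lt (n₁ - 1 - q.val) p q S hpq (by omega))
  · rw [Fin.ext hpq]
  · exact absurd h.symm (acceptsFrom_ne_of_lt (n₁ - 1 - p.val) q p S hpq (by omega))

/-! ### Counting states -/

theorem card_set_mem {α : Type*} [Fintype α] (a : α) :
    Nat.card {S : Set α // a ∈ S} = 2 ^ (Fintype.card α - 1) := by
  classical
  have e : {S : Finset α // S ∈ Finset.Icc {a} Finset.univ} ≃ {S : Set α // a ∈ S} :=
    Fintype.finsetEquivSet.subtypeEquiv fun S => by simp
  rw [← Nat.card_congr e, Nat.card_eq_fintype_card, Fintype.card_coe,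
    Finset.card_Icc_finset (Finset.subset_univ _), Finset.card_singleton, Finset.card_univ]

theorem card_prod_set_of_imp_mem {α β : Type*} [Fintype α] [Fintype β] (a : α) (b : β) :
    Nat.card {x : α × Set β // x.1 = a → b ∈ x.2} =
      (Fintype.card α - 1) * 2 ^ Fintype.card β + 2 ^ (Fintype.card β - 1) := by
  classical
  let e : {x : α × Set β // x.1 = a → b ∈ x.2} ≃ Σ q : α, {S : Set β // q = a → b ∈ S} :=
    { toFun := fun x => ⟨x.1.1, x.1.2, x.2⟩
      invFun := fun y => ⟨(y.1, y.2.1), y.2.2⟩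
      left_inv := fun _ => rfl
      right_inv := fun _ => rfl }
  have ha : Nat.card {S : Set β // a = a → b ∈ S} = 2 ^ (Fintype.card β - 1) := by
    rw [← card_set_mem b]
    exact Nat.card_congr (Equiv.subtypeEquivRight fun S => by simp)
  have hne : ∀ q ∈ Finset.univ.erase a,
      Nat.card {S : Set β // q = a → b ∈ S} = 2 ^ Fintype.card β := by
    intro q hq
    rw [← Fintype.card_set, ← Nat.card_eq_fintype_card]
    exact Nat.card_congr (Equiv.subtypeUnivEquiv fun S h => absurd h (Finset.ne_of_mem_erase hq))
  rw [Nat.card_congr e, Nat.card_sigma, ← Finset.sum_erase_add _ _ (Finset.mem_univ a), ha,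
    Finset.sum_congr rfl hne, Finset.sum_const, Finset.card_erase_of_mem (Finset.mem_univ a),
    Finset.card_univ, smul_eq_mul]

theorem card_concatState :
    Nat.card (DFA.ConcatState (dfaA n₁ h₁) (dfaB n₂ h₂)) =
      (n₁ - 1) * 2 ^ n₂ + 2 ^ (n₂ - 1) := by
  have := card_prod_set_of_imp_mem (⟨n₁ - 1, by omega⟩ : Fin n₁) (dfaB n₂ h₂).start
  rw [Fintype.card_fin, Fintype.card_fin] at this
  exact this

end Witness

/-- For `n₁, n₂ ≥ 2`, the minimal DFA for `L(A)L(B)` has exactly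
`(n₁−1)·2^{n₂} + 2^{n₂−1}` states. -/
theorem stmt10 (n₁ n₂ : ℕ) (h₁ : 2 ≤ n₁) (h₂ : 2 ≤ n₂) :
    (∃ (Q : Type) (_ : Fintype Q) (D : DFA Bool Q),
      D.accepts = (dfaA n₁ h₁).accepts * (dfaB n₂ h₂).accepts ∧
      Fintype.card Q = (n₁ - 1) * 2 ^ n₂ + 2 ^ (n₂ - 1)) ∧
    (∀ (Q : Type) (inst : Fintype Q) (D : DFA Bool Q),
      D.accepts = (dfaA n₁ h₁).accepts * (dfaB n₂ h₂).accepts →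
      (n₁ - 1) * 2 ^ n₂ + 2 ^ (n₂ - 1) ≤ @Fintype.card Q inst) := by
  classical
  have : Fintype (DFA.ConcatState (dfaA n₁ h₁) (dfaB n₂ h₂)) := Fintype.ofFinite _
  have hcard := card_concatState (h₁ := h₁) (h₂ := h₂)
  rw [Nat.card_eq_fintype_card] at hcard
  refine ⟨⟨_, inferInstance, _, DFA.concatRestrict_accepts _ _, hcard⟩, fun Q inst D hD => ?_⟩
  rw [← hcard]
  refine DFA.card_le_of_accepts_eq (witnessConcat h₁ h₂) Subtype.val
    (fun x => witnessConcat_exists_eval x.1.1 x.1.2 x.2)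
    (fun x y h => Subtype.ext (witnessConcat_acceptsFrom_injective h)) D ?_
  rw [hD, DFA.concat_accepts]
end
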